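/- arXiv:1305.6290 — 8 statements merged into one kernel-verified Lean document; each statement's English description precedes it below -/
import Mathlib

section
/- Let H : ℝ^d → ℝ be convex and coercive, let g : ℝ^d → ℝ be convex and Lipschitz continuous, and let t > 0. Then the Lax formula equals the Hopf formula: for every x ∈ ℝ^d, inf_{y ∈ ℝ^d} { (tH)*(x − y) + g(y) } = (tH + g*)*(x), where h* denotes the Legendre–Fenchel conjugate of h. -/
open Filter Topology
open scoped RealInnerProductSpace

/-- `f` is coercive: `f x / ‖x‖ → +∞` as `‖x‖ → ∞`. -/
def Coercive {d : ℕ} (f : EuclideanSpace ℝ (Fin d) → ℝ) : Prop :=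
  Tendsto (fun x => f x / ‖x‖) (Filter.comap (fun x : EuclideanSpace ℝ (Fin d) => ‖x‖) atTop) atTop

/-- The (real-valued) Legendre–Fenchel conjugate `f*(p) = sup_y (⟪p,y⟫ - f y)`. -/
noncomputable def legendreConj {d : ℕ} (f : EuclideanSpace ℝ (Fin d) → ℝ)
    (p : EuclideanSpace ℝ (Fin d)) : ℝ :=
  ⨆ y, (⟪p, y⟫ - f y)

/-- The extended-real-valued Legendre–Fenchel conjugate, needed since the conjugate of a
Lipschitz function takes the value `+∞`. -/
noncomputable def legendreConjE {d : ℕ} (f : EuclideanSpace ℝ (Fin d) → ℝ)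
    (p : EuclideanSpace ℝ (Fin d)) : EReal :=
  ⨆ y, ((⟪p, y⟫ - f y : ℝ) : EReal)

theorem exists_subgrad {d : ℕ} {f : EuclideanSpace ℝ (Fin d) → ℝ}
    (hf : ConvexOn ℝ Set.univ f) (x : EuclideanSpace ℝ (Fin d)) :
    ∃ p : EuclideanSpace ℝ (Fin d), ∀ z, f x + ⟪p, z - x⟫ ≤ f z := by
  have hc : Continuous f := hf.locallyLipschitz.continuous
  have hconv := hf.convex_strict_epigraph
  have hopen : IsOpen {p : EuclideanSpace ℝ (Fin d) × ℝ | p.1 ∈ Set.univ ∧ f p.1 < p.2} := by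
    simp only [Set.mem_univ, true_and]
    exact isOpen_lt (hc.comp continuous_fst) continuous_snd
  obtain ⟨L, hL⟩ := geometric_hahn_banach_open_point (x := (x, f x)) hconv hopen (by simp)
  set b : ℝ := L (0, 1) with hb
  have hsplit : ∀ z s, L (z, s) = L (z, 0) + s * b := by
    intro z s
    have : ((z, s) : EuclideanSpace ℝ (Fin d) × ℝ) = (z, 0) + s • (0, 1) := by simp
    rw [this, map_add, map_smul, smul_eq_mul]
  have hb0 : b < 0 := by
    have := hL (x, f x + 1) (by simp)
    rw [hsplit, hsplit x (f x)] at this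
    linarith
  have hle : ∀ z, L (z, 0) + f z * b ≤ L (x, 0) + f x * b := by
    intro z
    refine le_of_forall_pos_lt_add fun ε hε => ?_
    have := hL (z, f z + ε / (-b)) (by simpa using div_pos hε (neg_pos.2 hb0))
    rw [hsplit, hsplit x (f x)] at this
    have h2 : ε / (-b) * b = -ε := by
      have := hb0.ne
      field_simp
    nlinarith
  let l : StrongDual ℝ (EuclideanSpace ℝ (Fin d)) :=
    (-b)⁻¹ • L.comp (ContinuousLinearMap.inl ℝ (EuclideanSpace ℝ (Fin d)) ℝ)
  refine ⟨(InnerProductSpace.toDual ℝ _).symm l, fun z => ?_⟩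
  rw [InnerProductSpace.toDual_symm_apply, map_sub]
  have hl : ∀ z, l z = (-b)⁻¹ * L (z, 0) := fun z => by simp [l]
  rw [hl, hl, ← mul_sub, inv_mul_eq_div]
  have : (L (z, 0) - L (x, 0)) / (-b) ≤ f z - f x := by
    rw [div_le_iff₀ (neg_pos.2 hb0)]
    nlinarith [hle z]
  linarith

theorem conj_bdd {d : ℕ} {H : EuclideanSpace ℝ (Fin d) → ℝ}
    (hH : ConvexOn ℝ Set.univ H) (hHcoer : Coercive H) {t : ℝ} (ht : 0 < t)
    (w : EuclideanSpace ℝ (Fin d)) :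
    BddAbove (Set.range fun y => ⟪w, y⟫ - t * H y) := by
  obtain ⟨q, hq⟩ := exists_subgrad hH 0
  have h1 := hHcoer.eventually (eventually_ge_atTop (‖w‖ / t))
  rw [Filter.eventually_comap] at h1
  obtain ⟨R, hR⟩ := Filter.eventually_atTop.1 h1
  refine ⟨max 0 ((‖w‖ + t * ‖q‖) * max R 1 - t * H 0), ?_⟩
  rintro _ ⟨y, rfl⟩
  have hwy := real_inner_le_norm w y
  by_cases hy : max R 1 ≤ ‖y‖
  · refine le_max_of_le_left ?_
    have h2 := hR ‖y‖ ((le_max_left _ _).trans hy) y rfl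
    have hy0 : 0 < ‖y‖ := lt_of_lt_of_le one_pos ((le_max_right _ _).trans hy)
    rw [div_le_div_iff₀ ht hy0] at h2
    simp only
    linarith
  · refine le_max_of_le_right ?_
    have h3 := hq y
    rw [sub_zero] at h3
    have h4 := neg_le_of_abs_le (abs_real_inner_le_norm q y)
    have h5 : t * (H 0 - ‖q‖ * ‖y‖) ≤ t * H y := mul_le_mul_of_nonneg_left (by linarith) ht.le
    have h6 : (‖w‖ + t * ‖q‖) * ‖y‖ ≤ (‖w‖ + t * ‖q‖) * max R 1 :=
      mul_le_mul_of_nonneg_left (not_le.1 hy).le (by positivity)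
    simp only
    linarith

/-- For `H : ℝ^d → ℝ` convex and coercive, `g : ℝ^d → ℝ` convex and Lipschitz and `t > 0`,
the Lax formula coincides with the Hopf formula:
`inf_y { (tH)*(x - y) + g y } = (tH + g*)*(x)` for every `x`. -/
theorem lax_formula_eq_hopf_formula (d : ℕ) (H g : EuclideanSpace ℝ (Fin d) → ℝ)
    (hH : ConvexOn ℝ Set.univ H) (hHcoer : Coercive H)
    (hgconv : ConvexOn ℝ Set.univ g) (K : NNReal) (hg : LipschitzWith K g)
    (t : ℝ) (ht : 0 < t) :
    ∀ x : EuclideanSpace ℝ (Fin d),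
      ((⨅ y, (legendreConj (fun ξ => t * H ξ) (x - y) + g y) : ℝ) : EReal)
        = ⨆ p : EuclideanSpace ℝ (Fin d),
            (((⟪x, p⟫ - t * H p : ℝ) : EReal) - legendreConjE g p) := by
  have hbdd := conj_bdd hH hHcoer ht
  set L : EuclideanSpace ℝ (Fin d) → ℝ := legendreConj (fun ξ => t * H ξ) with hLdef
  have hL : ∀ w p, ⟪w, p⟫ - t * H p ≤ L w := fun w p => le_ciSup (hbdd w) p
  have hL' : ∀ w c, (∀ p, ⟪w, p⟫ - t * H p ≤ c) → L w ≤ c := fun w c h => ciSup_le h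
  obtain ⟨q, hq⟩ := exists_subgrad hgconv 0
  have hbelow : ∀ x, BddBelow (Set.range fun y => L (x - y) + g y) := by
    intro x
    refine ⟨g 0 + ⟪x, q⟫ - t * H q, ?_⟩
    rintro _ ⟨y, rfl⟩
    have h1 := hL (x - y) q
    have h2 := hq y
    rw [sub_zero, real_inner_comm] at h2
    rw [inner_sub_left] at h1
    simp only
    linarith
  set u : EuclideanSpace ℝ (Fin d) → ℝ := fun x => ⨅ y, (L (x - y) + g y) with hu
  have hule : ∀ x y, u x ≤ L (x - y) + g y := fun x y => ciInf_le (hbelow x) y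
  have hLconv : ∀ v w (a b : ℝ), 0 ≤ a → 0 ≤ b → a + b = 1 →
      L (a • v + b • w) ≤ a * L v + b * L w := by
    intro v w a b ha hb hab
    refine hL' _ _ fun p => ?_
    have h1 := mul_le_mul_of_nonneg_left (hL v p) ha
    have h2 := mul_le_mul_of_nonneg_left (hL w p) hb
    rw [inner_add_left, real_inner_smul_left, real_inner_smul_left]
    have h3 : t * H p = a * (t * H p) + b * (t * H p) := by rw [← add_mul, hab, one_mul]
    linarith
  have huconv : ConvexOn ℝ Set.univ u := by
    refine ⟨convex_univ, fun x₁ _ x₂ _ a b ha hb hab => ?_⟩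
    refine le_of_forall_pos_le_add fun ε hε => ?_
    obtain ⟨y₁, hy₁⟩ := exists_lt_of_ciInf_lt (show (⨅ y, (L (x₁ - y) + g y)) < u x₁ + ε from
      lt_add_of_pos_right _ hε)
    obtain ⟨y₂, hy₂⟩ := exists_lt_of_ciInf_lt (show (⨅ y, (L (x₂ - y) + g y)) < u x₂ + ε from
      lt_add_of_pos_right _ hε)
    have h1 := hule (a • x₁ + b • x₂) (a • y₁ + b • y₂)
    have h2 : a • x₁ + b • x₂ - (a • y₁ + b • y₂) = a • (x₁ - y₁) + b • (x₂ - y₂) := by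
      module
    rw [h2] at h1
    have h3 := hLconv (x₁ - y₁) (x₂ - y₂) a b ha hb hab
    have h4 := hgconv.2 (Set.mem_univ y₁) (Set.mem_univ y₂) ha hb hab
    have h5 := mul_le_mul_of_nonneg_left hy₁.le ha
    have h6 := mul_le_mul_of_nonneg_left hy₂.le hb
    have h7 : ε = a * ε + b * ε := by rw [← add_mul, hab, one_mul]
    simp only [smul_eq_mul] at h4 ⊢
    linarith
  intro x
  change ((u x : ℝ) : EReal) = _
  apply le_antisymm
  · obtain ⟨p, hp⟩ := exists_subgrad huconv x
    refine le_trans ?_ (le_iSup _ p)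
    obtain ⟨w, hw⟩ := exists_subgrad hH p
    have hLw : L (t • w) ≤ ⟪t • w, p⟫ - t * H p := by
      refine hL' _ _ fun z => ?_
      have h1 := mul_le_mul_of_nonneg_left (hw z) ht.le
      rw [inner_sub_right] at h1
      rw [real_inner_smul_left, real_inner_smul_left]
      linarith
    have hG : legendreConjE g p ≤ ((⟪x, p⟫ - t * H p - u x : ℝ) : EReal) := by
      refine iSup_le fun y => EReal.coe_le_coe_iff.2 ?_
      have h1 := hp (t • w + y)
      have h2 := hule (t • w + y) y
      rw [add_sub_cancel_right] at h2
      rw [inner_sub_right, inner_add_right, real_inner_comm (t • w) p,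
        real_inner_comm x p] at h1
      linarith
    calc ((u x : ℝ) : EReal)
        = ((⟪x, p⟫ - t * H p : ℝ) : EReal) - ((⟪x, p⟫ - t * H p - u x : ℝ) : EReal) := by
          rw [← EReal.coe_sub]; congr 1; ring
      _ ≤ _ := EReal.sub_le_sub le_rfl hG
  · refine iSup_le fun p => ?_
    have hge : ∀ y, ((⟪p, y⟫ - g y : ℝ) : EReal) ≤ legendreConjE g p := fun y =>
      le_iSup (fun y => ((⟪p, y⟫ - g y : ℝ) : EReal)) y
    generalize legendreConjE g p = G at hge
    induction G with
    | bot => exact absurd (hge 0) (by simp)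
    | top => simp
    | coe G =>
      rw [← EReal.coe_sub, EReal.coe_le_coe_iff]
      refine le_ciInf fun y => ?_
      have h1 := EReal.coe_le_coe_iff.1 (hge y)
      have h2 := hL (x - y) p
      rw [inner_sub_left, real_inner_comm p y] at h2
      linarith
end

section
/- For every t₁, t₂ > 0 and every x ∈ ℝ^d, the infimum defining the multi-time Lax formula w(t₁,t₂,x) = inf_{y ∈ ℝ^d} { (t₁H₁ + t₂H₂)*(x − y) + g(y) } is attained at some point y ∈ ℝ^d (i.e. the infimum is a minimum). Moreover, w is a continuous function on (0,∞)² × ℝ^d. -/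
open Filter Topology
open scoped RealInnerProductSpace

/-- The multi-time Lax formula `w(t₁,t₂,x) = inf_y { (t₁H₁ + t₂H₂)*(x - y) + g y }`. -/
noncomputable def lax {d : ℕ} (H₁ H₂ g : EuclideanSpace ℝ (Fin d) → ℝ) (t₁ t₂ : ℝ)
    (x : EuclideanSpace ℝ (Fin d)) : ℝ :=
  ⨅ y, (legendreConj (fun ξ => t₁ * H₁ ξ + t₂ * H₂ ξ) (x - y) + g y)

theorem lax_aux_abs {X E : Type*} [TopologicalSpace X] [NormedAddCommGroup E] [ProperSpace E]
    (S : Set X) (hS : IsOpen S) (Φ : X → E → ℝ)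
    (hΦ : ContinuousOn (fun z : X × E => Φ z.1 z.2) (S ×ˢ Set.univ))
    (hco : ∀ p0 ∈ S, ∀ c : ℝ, ∃ R : ℝ, ∀ᶠ p in 𝓝 p0, ∀ y, R < ‖y‖ → c < Φ p y) :
    (∀ p ∈ S, ∃ y, Φ p y = ⨅ y, Φ p y) ∧ ContinuousOn (fun p => ⨅ y, Φ p y) S := by
  have hat : ∀ p ∈ S, ∀ y, ContinuousAt (fun z : X × E => Φ z.1 z.2) (p, y) := fun p hp y =>
    hΦ.continuousAt ((hS.prod isOpen_univ).mem_nhds ⟨hp, trivial⟩)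
  have hmin : ∀ p ∈ S, ∃ y, ∀ y', Φ p y ≤ Φ p y' := by
    intro p hp
    have hc : Continuous (Φ p) := by
      rw [continuous_iff_continuousAt]
      intro y
      have h2 : ContinuousAt (fun y : E => (p, y)) y := by fun_prop
      exact ContinuousAt.comp (f := fun y : E => (p, y)) (hat p hp y) h2
    apply hc.exists_forall_le_of_isBounded (0 : E)
    obtain ⟨R, hR⟩ := hco p hp (Φ p 0)
    have hR := hR.self_of_nhds
    refine (Metric.isBounded_closedBall (x := (0:E)) (r := R)).subset ?_
    intro y hy
    simp only [Set.mem_ofPred_eq] at hy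
    rw [mem_closedBall_zero_iff]
    by_contra h
    push Not at h
    exact absurd (hR y h) (not_lt.mpr hy)
  have hle : ∀ p ∈ S, ∀ y, (⨅ y, Φ p y) ≤ Φ p y := by
    intro p hp y
    obtain ⟨y0, hy0⟩ := hmin p hp
    exact ciInf_le ⟨Φ p y0, by rintro _ ⟨z, rfl⟩; exact hy0 z⟩ y
  have hatt : ∀ p ∈ S, ∃ y, Φ p y = ⨅ y, Φ p y := by
    intro p hp
    obtain ⟨y0, hy0⟩ := hmin p hp
    exact ⟨y0, le_antisymm (le_ciInf hy0) (hle p hp y0)⟩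
  refine ⟨hatt, ?_⟩
  intro p0 hp0
  apply ContinuousAt.continuousWithinAt
  have hSn : ∀ᶠ p in 𝓝 p0, p ∈ S := hS.mem_nhds hp0
  refine tendsto_order.mpr ⟨?_, ?_⟩
  · intro c hc
    obtain ⟨R, hR⟩ := hco p0 hp0 c
    have hK : IsCompact (Metric.closedBall (0 : E) R) := isCompact_closedBall _ _
    have h1 : ∀ᶠ p in 𝓝 p0, ∀ y ∈ Metric.closedBall (0 : E) R, c < Φ p y := by
      apply hK.eventually_forall_of_forall_eventually
      intro y _
      exact (hat p0 hp0 y).eventually (lt_mem_nhds (lt_of_lt_of_le hc (hle p0 hp0 y)))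
    filter_upwards [hSn, hR, h1] with p hp hRp h1p
    obtain ⟨y, hy⟩ := hatt p hp
    rw [← hy]
    by_cases h : R < ‖y‖
    · exact hRp y h
    · exact h1p y (by rw [mem_closedBall_zero_iff]; exact not_lt.mp h)
  · intro c hc
    obtain ⟨y, hy⟩ := hatt p0 hp0
    replace hc : Φ p0 y < c := hy.trans_lt hc
    have h2 : ContinuousAt (fun p : X => (p, y)) p0 := by fun_prop
    have h3 := ContinuousAt.comp (f := fun p : X => (p, y)) (hat p0 hp0 y) h2
    filter_upwards [hSn, h3.eventually (gt_mem_nhds hc)] with p hp h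
    exact lt_of_le_of_lt (hle p hp y) h

theorem lax_aux_bddball {d : ℕ} {H : EuclideanSpace ℝ (Fin d) → ℝ} (hc : Continuous H) (R : ℝ) :
    ∃ M : ℝ, 0 ≤ M ∧ ∀ y, ‖y‖ ≤ R → |H y| ≤ M := by
  obtain ⟨C, hC⟩ := (isCompact_closedBall (0 : EuclideanSpace ℝ (Fin d)) R).exists_bound_of_continuousOn
    hc.continuousOn
  refine ⟨max C 0, le_max_right _ _, fun y hy => ?_⟩
  exact (hC y (by rwa [mem_closedBall_zero_iff])).trans (le_max_left _ _)

theorem lax_aux_coer {d : ℕ} {H : EuclideanSpace ℝ (Fin d) → ℝ} (hc : Continuous H)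
    (hco : Coercive H) (B : ℝ) (hB : 0 ≤ B) : ∃ C : ℝ, ∀ y, B * ‖y‖ - C ≤ H y := by
  have h := hco.eventually_ge_atTop B
  rw [Filter.eventually_comap] at h
  obtain ⟨A, hA⟩ := Filter.eventually_atTop.mp h
  obtain ⟨M, hM0, hM⟩ := lax_aux_bddball hc (max A 1)
  refine ⟨B * max A 1 + M, fun y => ?_⟩
  by_cases hy : ‖y‖ ≤ max A 1
  · have h1 := neg_le_of_abs_le (hM y hy)
    have h2 := mul_le_mul_of_nonneg_left hy hB
    linarith
  · push Not at hy
    have hpos : 0 < ‖y‖ := lt_of_lt_of_le one_pos ((le_max_right A 1).trans hy.le)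
    have h1 := hA ‖y‖ ((le_max_left A 1).trans hy.le) y rfl
    rw [le_div_iff₀ hpos] at h1
    have h2 : 0 ≤ B * max A 1 := mul_nonneg hB (le_trans zero_le_one (le_max_right _ _))
    linarith

theorem lax_aux_bdd {d : ℕ} {H₁ H₂ : EuclideanSpace ℝ (Fin d) → ℝ} (hc₁ : Continuous H₁)
    (hc₂ : Continuous H₂) (h₁ : Coercive H₁) (h₂ : Coercive H₂) {t₁ t₂ : ℝ} (ht₁ : 0 < t₁)
    (ht₂ : 0 < t₂) (q : EuclideanSpace ℝ (Fin d)) :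
    BddAbove (Set.range fun y => ⟪q, y⟫ - (t₁ * H₁ y + t₂ * H₂ y)) := by
  obtain ⟨C₁, hC₁⟩ := lax_aux_coer hc₁ h₁ (‖q‖ / t₁) (by positivity)
  obtain ⟨C₂, hC₂⟩ := lax_aux_coer hc₂ h₂ 0 le_rfl
  refine ⟨t₁ * C₁ + t₂ * C₂, ?_⟩
  rintro _ ⟨y, rfl⟩
  have e1 := mul_le_mul_of_nonneg_left (hC₁ y) ht₁.le
  have e2 := mul_le_mul_of_nonneg_left (hC₂ y) ht₂.le
  have e3 := real_inner_le_norm q y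
  have e4 : t₁ * (‖q‖ / t₁ * ‖y‖ - C₁) = ‖q‖ * ‖y‖ - t₁ * C₁ := by field_simp
  rw [e4] at e1
  simp only
  linarith

theorem lax_aux_cont {d : ℕ} {H₁ H₂ : EuclideanSpace ℝ (Fin d) → ℝ} (hc₁ : Continuous H₁)
    (hc₂ : Continuous H₂) (h₁ : Coercive H₁) (h₂ : Coercive H₂) :
    ContinuousOn (fun p : ℝ × ℝ × EuclideanSpace ℝ (Fin d) =>
      legendreConj (fun ξ => p.1 * H₁ ξ + p.2.1 * H₂ ξ) p.2.2)
      {p : ℝ × ℝ × EuclideanSpace ℝ (Fin d) | 0 < p.1 ∧ 0 < p.2.1} := by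
  have hopen : IsOpen {p : ℝ × ℝ × EuclideanSpace ℝ (Fin d) | 0 < p.1 ∧ 0 < p.2.1} := by
    rw [Set.setOf_and]
    exact (isOpen_lt continuous_const (by fun_prop)).inter
      (isOpen_lt continuous_const (by fun_prop))
  refine ConvexOn.continuousOn hopen ⟨?_, ?_⟩
  · rintro ⟨s₁, s₂, q⟩ ⟨hs₁, hs₂⟩ ⟨r₁, r₂, k⟩ ⟨hr₁, hr₂⟩ a b ha hb hab
    simp only at hs₁ hs₂ hr₁ hr₂
    simp only [Set.mem_ofPred_eq, Prod.smul_mk, Prod.mk_add_mk, smul_eq_mul]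
    rcases ha.eq_or_lt with rfl | ha
    · have : b = 1 := by linarith
      subst this; constructor <;> linarith
    · constructor <;> positivity
  · rintro ⟨s₁, s₂, q⟩ ⟨hs₁, hs₂⟩ ⟨r₁, r₂, k⟩ ⟨hr₁, hr₂⟩ a b ha hb hab
    simp only at hs₁ hs₂ hr₁ hr₂
    simp only [Prod.smul_mk, Prod.mk_add_mk, smul_eq_mul]
    unfold legendreConj
    apply ciSup_le
    intro y
    have e1 := le_ciSup (lax_aux_bdd hc₁ hc₂ h₁ h₂ hs₁ hs₂ q) y
    have e2 := le_ciSup (lax_aux_bdd hc₁ hc₂ h₁ h₂ hr₁ hr₂ k) y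
    have e3 := mul_le_mul_of_nonneg_left e1 ha
    have e4 := mul_le_mul_of_nonneg_left e2 hb
    refine le_trans (le_of_eq ?_) (add_le_add e3 e4)
    rw [inner_add_left, real_inner_smul_left, real_inner_smul_left]
    ring

/-- For `H₁, H₂` convex and coercive and `g` Lipschitz, the infimum defining the multi-time
Lax formula is attained for all `t₁, t₂ > 0` and all `x`; moreover `w` is continuous on
`(0,∞)² × ℝ^d`. -/
theorem lax_inf_attained_and_continuous (d : ℕ) (H₁ H₂ g : EuclideanSpace ℝ (Fin d) → ℝ)
    (hH₁ : ConvexOn ℝ Set.univ H₁) (hH₂ : ConvexOn ℝ Set.univ H₂)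
    (hH₁coer : Coercive H₁) (hH₂coer : Coercive H₂)
    (K : NNReal) (hg : LipschitzWith K g) :
    (∀ t₁ t₂ : ℝ, 0 < t₁ → 0 < t₂ → ∀ x : EuclideanSpace ℝ (Fin d),
      ∃ y : EuclideanSpace ℝ (Fin d),
        legendreConj (fun ξ => t₁ * H₁ ξ + t₂ * H₂ ξ) (x - y) + g y = lax H₁ H₂ g t₁ t₂ x) ∧
    ContinuousOn (fun p : ℝ × ℝ × EuclideanSpace ℝ (Fin d) => lax H₁ H₂ g p.1 p.2.1 p.2.2)
      {p : ℝ × ℝ × EuclideanSpace ℝ (Fin d) | 0 < p.1 ∧ 0 < p.2.1} := by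
  have hc₁ : Continuous H₁ := continuousOn_univ.mp (hH₁.continuousOn isOpen_univ)
  have hc₂ : Continuous H₂ := continuousOn_univ.mp (hH₂.continuousOn isOpen_univ)
  have hopen : IsOpen {p : ℝ × ℝ × EuclideanSpace ℝ (Fin d) | 0 < p.1 ∧ 0 < p.2.1} := by
    rw [Set.setOf_and]
    exact (isOpen_lt continuous_const (by fun_prop)).inter
      (isOpen_lt continuous_const (by fun_prop))
  have key := lax_aux_abs {p : ℝ × ℝ × EuclideanSpace ℝ (Fin d) | 0 < p.1 ∧ 0 < p.2.1} hopen
    (fun p y => legendreConj (fun ξ => p.1 * H₁ ξ + p.2.1 * H₂ ξ) (p.2.2 - y) + g y) ?_ ?_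
  · exact ⟨fun t₁ t₂ ht₁ ht₂ x => key.1 (t₁, t₂, x) ⟨ht₁, ht₂⟩, key.2⟩
  · refine ContinuousOn.add ?_ (hg.continuous.comp continuous_snd).continuousOn
    refine (lax_aux_cont hc₁ hc₂ hH₁coer hH₂coer).comp
      (f := fun z : (ℝ × ℝ × EuclideanSpace ℝ (Fin d)) × EuclideanSpace ℝ (Fin d) =>
        (z.1.1, z.1.2.1, z.1.2.2 - z.2)) (by fun_prop) ?_
    rintro z ⟨hz, -⟩
    exact hz
  · rintro ⟨s₁, s₂, x0⟩ ⟨hs₁, hs₂⟩ c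
    simp only at hs₁ hs₂
    obtain ⟨M₁, hM₁0, hM₁⟩ := lax_aux_bddball hc₁ (K + 1)
    obtain ⟨M₂, hM₂0, hM₂⟩ := lax_aux_bddball hc₂ (K + 1)
    refine ⟨c + (K + 1) * (‖x0‖ + 1) + (s₁ + 1) * M₁ + (s₂ + 1) * M₂ - g 0, ?_⟩
    have n1 : ∀ᶠ p : ℝ × ℝ × EuclideanSpace ℝ (Fin d) in 𝓝 (s₁, s₂, x0), p.1 < s₁ + 1 :=
      (isOpen_lt (by fun_prop) (by fun_prop)).mem_nhds (by simp)
    have n2 : ∀ᶠ p : ℝ × ℝ × EuclideanSpace ℝ (Fin d) in 𝓝 (s₁, s₂, x0), p.2.1 < s₂ + 1 :=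
      (isOpen_lt (by fun_prop) (by fun_prop)).mem_nhds (by simp)
    have n3 : ∀ᶠ p : ℝ × ℝ × EuclideanSpace ℝ (Fin d) in 𝓝 (s₁, s₂, x0), ‖p.2.2‖ < ‖x0‖ + 1 :=
      (isOpen_lt (by fun_prop) (by fun_prop)).mem_nhds (by simp)
    filter_upwards [hopen.mem_nhds (show (s₁, s₂, x0) ∈ _ from ⟨hs₁, hs₂⟩), n1, n2, n3]
    rintro ⟨t₁, t₂, x⟩ ⟨ht₁, ht₂⟩ m1 m2 m3 y hy
    simp only at ht₁ ht₂ m1 m2 m3 ⊢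
    have hK : (0 : ℝ) ≤ K := K.2
    set q := x - y with hq
    set z := ((K + 1 : ℝ) * ‖q‖⁻¹) • q with hz
    have hzn : ‖z‖ ≤ K + 1 := by
      rw [hz, norm_smul, Real.norm_of_nonneg (by positivity), mul_assoc]
      exact mul_le_of_le_one_right (by positivity) inv_mul_le_one
    have hin : ⟪q, z⟫ = (K + 1) * ‖q‖ := by
      rw [hz, real_inner_smul_right, real_inner_self_eq_norm_sq]
      by_cases h0 : ‖q‖ = 0
      · simp [h0]
      · field_simp
    have e1 : ⟪q, z⟫ - (t₁ * H₁ z + t₂ * H₂ z) ≤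
        legendreConj (fun ξ => t₁ * H₁ ξ + t₂ * H₂ ξ) q :=
      le_ciSup (lax_aux_bdd hc₁ hc₂ hH₁coer hH₂coer ht₁ ht₂ q) z
    have e2 : t₁ * H₁ z ≤ (s₁ + 1) * M₁ :=
      (mul_le_mul_of_nonneg_left ((le_abs_self _).trans (hM₁ z hzn)) ht₁.le).trans
        (mul_le_mul_of_nonneg_right m1.le hM₁0)
    have e3 : t₂ * H₂ z ≤ (s₂ + 1) * M₂ :=
      (mul_le_mul_of_nonneg_left ((le_abs_self _).trans (hM₂ z hzn)) ht₂.le).trans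
        (mul_le_mul_of_nonneg_right m2.le hM₂0)
    have e4 : g 0 - K * ‖y‖ ≤ g y := by
      have := hg.dist_le_mul 0 y
      rw [Real.dist_eq, dist_zero_left] at this
      linarith [le_abs_self (g 0 - g y)]
    have e5 : ‖y‖ - (‖x0‖ + 1) ≤ ‖q‖ := by
      have := norm_sub_norm_le y x
      rw [norm_sub_rev] at this
      linarith
    have e6 := mul_le_mul_of_nonneg_left e5 (show (0:ℝ) ≤ K + 1 by positivity)
    rw [hin] at e1
    linarith
end

section
/- For every t₁, t₂ > 0 and every x ∈ ℝ^d, one has the two-sided bound inf_{ξ ∈ ℝ^d} (t₁H₁(ξ) + t₂H₂(ξ)) ≤ g(x) − w(t₁,t₂,x) ≤ max_{‖ξ‖ ≤ Lip(g)} (t₁H₁(ξ) + t₂H₂(ξ)). In particular, w(t₁,t₂,x) → g(x) as (t₁,t₂) → (0,0), uniformly in x ∈ ℝ^d. -/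
open Filter Topology Metric
open scoped RealInnerProductSpace

theorem coercive_lower {d : ℕ} (H : EuclideanSpace ℝ (Fin d) → ℝ) (hc : Continuous H)
    (hH : Coercive H) (C : ℝ) (hC : 0 ≤ C) : ∃ B, ∀ ξ, C * ‖ξ‖ - B ≤ H ξ := by
  have h1 := hH.eventually_ge_atTop C
  rw [Filter.eventually_comap] at h1
  obtain ⟨R, hR⟩ := Filter.eventually_atTop.1 h1
  obtain ⟨m, hm⟩ := (isCompact_closedBall (0 : EuclideanSpace ℝ (Fin d)) (max R 1)).bddBelow_image
    hc.continuousOn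
  have hR1 : (1 : ℝ) ≤ max R 1 := le_max_right _ _
  refine ⟨C * max R 1 + |m|, fun ξ => ?_⟩
  rcases le_total ‖ξ‖ (max R 1) with h | h
  · have h2 : m ≤ H ξ := hm ⟨ξ, by simpa using h, rfl⟩
    have h3 := neg_abs_le m
    have h4 := mul_le_mul_of_nonneg_left h hC
    linarith
  · have h2 := hR ‖ξ‖ ((le_max_left _ _).trans h) ξ rfl
    have h0 : 0 < ‖ξ‖ := by linarith
    rw [le_div_iff₀ h0] at h2
    have h3 := abs_nonneg m
    have h4 : 0 ≤ C * max R 1 := by positivity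
    linarith

theorem conj_bdd_s5 {d : ℕ} (H₁ H₂ : EuclideanSpace ℝ (Fin d) → ℝ) (hc₁ : Continuous H₁)
    (hc₂ : Continuous H₂) (h₁ : Coercive H₁) (h₂ : Coercive H₂) (t₁ t₂ : ℝ) (ht₁ : 0 < t₁)
    (ht₂ : 0 < t₂) (p : EuclideanSpace ℝ (Fin d)) :
    BddAbove (Set.range fun ξ => ⟪p, ξ⟫ - (t₁ * H₁ ξ + t₂ * H₂ ξ)) := by
  obtain ⟨B₁, hB₁⟩ := coercive_lower H₁ hc₁ h₁ (‖p‖ / t₁) (by positivity)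
  obtain ⟨B₂, hB₂⟩ := coercive_lower H₂ hc₂ h₂ 0 le_rfl
  refine ⟨t₁ * B₁ + t₂ * B₂, ?_⟩
  rintro _ ⟨ξ, rfl⟩
  have e1 := mul_le_mul_of_nonneg_left (hB₁ ξ) ht₁.le
  have e2 := mul_le_mul_of_nonneg_left (hB₂ ξ) ht₂.le
  have e3 : t₁ * (‖p‖ / t₁ * ‖ξ‖ - B₁) = ‖p‖ * ‖ξ‖ - t₁ * B₁ := by field_simp
  have e4 := real_inner_le_norm p ξ
  simp only
  linarith

/-- Two-sided bound `inf_ξ (t₁H₁(ξ)+t₂H₂(ξ)) ≤ g x - w(t₁,t₂,x) ≤ max_{‖ξ‖ ≤ Lip(g)}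
(t₁H₁(ξ)+t₂H₂(ξ))`; in particular `w(t₁,t₂,·) → g` uniformly as `(t₁,t₂) → (0,0)` with
`t₁,t₂ > 0`. -/
theorem lax_initial_bound_and_uniform_convergence (d : ℕ)
    (H₁ H₂ g : EuclideanSpace ℝ (Fin d) → ℝ)
    (hH₁ : ConvexOn ℝ Set.univ H₁) (hH₂ : ConvexOn ℝ Set.univ H₂)
    (hH₁coer : Coercive H₁) (hH₂coer : Coercive H₂)
    (K : NNReal) (hg : LipschitzWith K g) :
    (∀ t₁ t₂ : ℝ, 0 < t₁ → 0 < t₂ → ∀ x : EuclideanSpace ℝ (Fin d),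
      (⨅ ξ : EuclideanSpace ℝ (Fin d), (t₁ * H₁ ξ + t₂ * H₂ ξ)) ≤ g x - lax H₁ H₂ g t₁ t₂ x ∧
      g x - lax H₁ H₂ g t₁ t₂ x
        ≤ sSup ((fun ξ => t₁ * H₁ ξ + t₂ * H₂ ξ) '' closedBall (0 : EuclideanSpace ℝ (Fin d)) K)) ∧
    TendstoUniformly (fun t : ℝ × ℝ => fun x => lax H₁ H₂ g t.1 t.2 x) g
      (𝓝[Set.Ioi (0:ℝ) ×ˢ Set.Ioi (0:ℝ)] (0, 0)) := by
  have hc₁ : Continuous H₁ := continuousOn_univ.1 (hH₁.continuousOn isOpen_univ)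
  have hc₂ : Continuous H₂ := continuousOn_univ.1 (hH₂.continuousOn isOpen_univ)
  have main : ∀ t₁ t₂ : ℝ, 0 < t₁ → 0 < t₂ → ∀ x : EuclideanSpace ℝ (Fin d),
      (⨅ ξ : EuclideanSpace ℝ (Fin d), (t₁ * H₁ ξ + t₂ * H₂ ξ)) ≤ g x - lax H₁ H₂ g t₁ t₂ x ∧
      g x - lax H₁ H₂ g t₁ t₂ x
        ≤ sSup ((fun ξ => t₁ * H₁ ξ + t₂ * H₂ ξ) ''
          closedBall (0 : EuclideanSpace ℝ (Fin d)) K) := by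
    intro t₁ t₂ ht₁ ht₂ x
    have hb := conj_bdd_s5 H₁ H₂ hc₁ hc₂ hH₁coer hH₂coer t₁ t₂ ht₁ ht₂
    set S := sSup ((fun ξ => t₁ * H₁ ξ + t₂ * H₂ ξ) ''
          closedBall (0 : EuclideanSpace ℝ (Fin d)) K) with hS
    have hSb : BddAbove ((fun ξ => t₁ * H₁ ξ + t₂ * H₂ ξ) ''
          closedBall (0 : EuclideanSpace ℝ (Fin d)) K) :=
      (isCompact_closedBall _ _).bddAbove_image (by fun_prop)
    have key : ∀ y, g x - S ≤
        legendreConj (fun ξ => t₁ * H₁ ξ + t₂ * H₂ ξ) (x - y) + g y := by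
      intro y
      obtain ⟨ξ, hξ, hξ2⟩ : ∃ ξ : EuclideanSpace ℝ (Fin d), ‖ξ‖ ≤ K ∧
          ⟪x - y, ξ⟫ = K * ‖x - y‖ := by
        by_cases h : x - y = 0
        · exact ⟨0, by simp, by simp [h]⟩
        · have hn : ‖x - y‖ ≠ 0 := norm_ne_zero_iff.2 h
          refine ⟨((K : ℝ) / ‖x - y‖) • (x - y), ?_, ?_⟩
          · rw [norm_smul, norm_div, norm_norm, div_mul_cancel₀ _ hn]
            simp
          · rw [real_inner_smul_right, real_inner_self_eq_norm_sq]
            field_simp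
      have e1 : ⟪x - y, ξ⟫ - (t₁ * H₁ ξ + t₂ * H₂ ξ) ≤
          legendreConj (fun ξ => t₁ * H₁ ξ + t₂ * H₂ ξ) (x - y) := le_ciSup (hb (x - y)) ξ
      have e2 : t₁ * H₁ ξ + t₂ * H₂ ξ ≤ S := le_csSup hSb ⟨ξ, by simpa using hξ, rfl⟩
      have e3 := hg.dist_le_mul x y
      rw [Real.dist_eq, dist_eq_norm] at e3
      have e4 := le_abs_self (g x - g y)
      linarith
    constructor
    · have e1 : lax H₁ H₂ g t₁ t₂ x ≤
          legendreConj (fun ξ => t₁ * H₁ ξ + t₂ * H₂ ξ) (x - x) + g x :=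
        ciInf_le ⟨g x - S, by rintro _ ⟨y, rfl⟩; exact key y⟩ x
      have e2 : legendreConj (fun ξ => t₁ * H₁ ξ + t₂ * H₂ ξ) (x - x) ≤
          - ⨅ ξ : EuclideanSpace ℝ (Fin d), (t₁ * H₁ ξ + t₂ * H₂ ξ) := by
        refine ciSup_le fun ξ => ?_
        have hbb : BddBelow (Set.range fun ξ : EuclideanSpace ℝ (Fin d) =>
            t₁ * H₁ ξ + t₂ * H₂ ξ) := by
          obtain ⟨B, hB⟩ := hb 0
          refine ⟨-B, ?_⟩
          rintro _ ⟨ξ, rfl⟩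
          have := hB ⟨ξ, rfl⟩
          simp only [inner_zero_left] at this
          simp only
          linarith
        have := ciInf_le hbb ξ
        simp only [sub_self, inner_zero_left]
        linarith
      linarith
    · have : g x - S ≤ lax H₁ H₂ g t₁ t₂ x := le_ciInf key
      linarith
  refine ⟨main, ?_⟩
  obtain ⟨B₁, hB₁⟩ := coercive_lower H₁ hc₁ hH₁coer 0 le_rfl
  obtain ⟨B₂, hB₂⟩ := coercive_lower H₂ hc₂ hH₂coer 0 le_rfl
  obtain ⟨M₁, hM₁⟩ := (isCompact_closedBall (0 : EuclideanSpace ℝ (Fin d)) K).bddAbove_image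
    hc₁.continuousOn
  obtain ⟨M₂, hM₂⟩ := (isCompact_closedBall (0 : EuclideanSpace ℝ (Fin d)) K).bddAbove_image
    hc₂.continuousOn
  rw [Metric.tendstoUniformly_iff]
  intro ε hε
  have t1 : Tendsto (fun t : ℝ × ℝ => t.1 * B₁ + t.2 * B₂)
      (𝓝[Set.Ioi (0:ℝ) ×ˢ Set.Ioi (0:ℝ)] (0, 0)) (𝓝 0) := by
    refine Tendsto.mono_left ?_ nhdsWithin_le_nhds
    have : Continuous (fun t : ℝ × ℝ => t.1 * B₁ + t.2 * B₂) := by fun_prop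
    simpa using this.tendsto (0, 0)
  have t2 : Tendsto (fun t : ℝ × ℝ => t.1 * M₁ + t.2 * M₂)
      (𝓝[Set.Ioi (0:ℝ) ×ˢ Set.Ioi (0:ℝ)] (0, 0)) (𝓝 0) := by
    refine Tendsto.mono_left ?_ nhdsWithin_le_nhds
    have : Continuous (fun t : ℝ × ℝ => t.1 * M₁ + t.2 * M₂) := by fun_prop
    simpa using this.tendsto (0, 0)
  filter_upwards [t1.eventually_lt_const hε, t2.eventually_lt_const hε, self_mem_nhdsWithin]
    with t h1 h2 ht x
  obtain ⟨p1, p2⟩ := ht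
  have p1 : 0 < t.1 := p1
  have p2 : 0 < t.2 := p2
  obtain ⟨m1, m2⟩ := main t.1 t.2 p1 p2 x
  have l1 : -(t.1 * B₁ + t.2 * B₂) ≤
      ⨅ ξ : EuclideanSpace ℝ (Fin d), (t.1 * H₁ ξ + t.2 * H₂ ξ) := by
    refine le_ciInf fun ξ => ?_
    have e1 := mul_le_mul_of_nonneg_left (hB₁ ξ) p1.le
    have e2 := mul_le_mul_of_nonneg_left (hB₂ ξ) p2.le
    linarith
  have l2 : sSup ((fun ξ => t.1 * H₁ ξ + t.2 * H₂ ξ) ''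
      closedBall (0 : EuclideanSpace ℝ (Fin d)) K) ≤ t.1 * M₁ + t.2 * M₂ := by
    refine csSup_le ⟨_, 0, by simp, rfl⟩ ?_
    rintro _ ⟨ξ, hξ, rfl⟩
    have e1 := mul_le_mul_of_nonneg_left (hM₁ ⟨ξ, hξ, rfl⟩) p1.le
    have e2 := mul_le_mul_of_nonneg_left (hM₂ ⟨ξ, hξ, rfl⟩) p2.le
    simp only
    linarith
  rw [Real.dist_eq, abs_lt]
  constructor <;> linarith
end

section
/- Let (t₁,t₂,x) ∈ (0,∞)² × ℝ^d be a point at which the multi-time Lax formula w is (totally) differentiable. Then both equations ∂_{t₁} w(t₁,t₂,x) + H₁(Dw(t₁,t₂,x)) = 0 and ∂_{t₂} w(t₁,t₂,x) + H₂(Dw(t₁,t₂,x)) = 0 hold, where Dw denotes the spatial gradient of w. -/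
open Filter Topology
open scoped RealInnerProductSpace

local notation "𝔼" d => EuclideanSpace ℝ (Fin d)

/-- Superlinear growth: `F` dominates every multiple of the norm up to a constant. -/
def SuperLin {d : ℕ} (F : (𝔼 d) → ℝ) : Prop :=
  ∀ R : ℝ, ∃ C : ℝ, ∀ y, R * ‖y‖ - C ≤ F y

lemma superLin_of_coercive {d : ℕ} {H : (𝔼 d) → ℝ} (hc : Continuous H) (h : Coercive H) :
    SuperLin H := by
  intro R
  have h1 := h.eventually (eventually_ge_atTop R)
  rw [Filter.eventually_comap] at h1
  obtain ⟨r, hr⟩ := Filter.eventually_atTop.1 h1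
  have hcomp : IsCompact (Metric.closedBall (0 : 𝔼 d) (max r 1)) := isCompact_closedBall _ _
  have hcont : Continuous (fun y => R * ‖y‖ - H y) := by fun_prop
  obtain ⟨C, hC⟩ := hcomp.bddAbove_image hcont.continuousOn
  refine ⟨max C 0, fun y => ?_⟩
  by_cases hy : ‖y‖ ≤ max r 1
  · have := hC ⟨y, by simpa using hy, rfl⟩
    simp only at this
    have := le_max_left C 0
    linarith
  · push Not at hy
    have hy1 : r ≤ ‖y‖ := (le_max_left _ _).trans hy.le
    have hy2 : 0 < ‖y‖ := lt_of_lt_of_le one_pos ((le_max_right r 1).trans hy.le)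
    have := hr _ hy1 y rfl
    have h3 := (le_div_iff₀ hy2).1 this
    have := le_max_right C 0
    linarith

lemma superLin_comb {d : ℕ} {H₁ H₂ : (𝔼 d) → ℝ} (h1 : SuperLin H₁) (h2 : SuperLin H₂)
    {s t : ℝ} (hs : 0 < s) (ht : 0 < t) : SuperLin (fun ξ => s * H₁ ξ + t * H₂ ξ) := by
  intro R
  obtain ⟨C1, hC1⟩ := h1 (R / s)
  obtain ⟨C2, hC2⟩ := h2 0
  refine ⟨s * C1 + t * C2, fun y => ?_⟩
  have e1 := mul_le_mul_of_nonneg_left (hC1 y) hs.le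
  have e2 := mul_le_mul_of_nonneg_left (hC2 y) ht.le
  have e3 : s * (R / s * ‖y‖ - C1) = R * ‖y‖ - s * C1 := by field_simp
  rw [e3] at e1
  simp only
  nlinarith

lemma conj_bdd_s7 {d : ℕ} {F : (𝔼 d) → ℝ} (hF : SuperLin F) (p : 𝔼 d) :
    BddAbove (Set.range fun y => ⟪p, y⟫ - F y) := by
  obtain ⟨C, hC⟩ := hF ‖p‖
  refine ⟨C, ?_⟩
  rintro _ ⟨y, rfl⟩
  have := hC y
  have := real_inner_le_norm p y
  simp only
  linarith

lemma le_conj {d : ℕ} {F : (𝔼 d) → ℝ} (hF : SuperLin F) (p y : 𝔼 d) :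
    ⟪p, y⟫ - F y ≤ legendreConj F p := le_ciSup (conj_bdd_s7 hF p) y

lemma conj_le {d : ℕ} {F : (𝔼 d) → ℝ} {p : 𝔼 d} {c : ℝ} (h : ∀ y, ⟪p, y⟫ - F y ≤ c) :
    legendreConj F p ≤ c := ciSup_le h

lemma conj_continuous {d : ℕ} {F : (𝔼 d) → ℝ} (hF : SuperLin F) :
    Continuous (legendreConj F) := by
  have : ConvexOn ℝ Set.univ (legendreConj F) := by
    refine ⟨convex_univ, fun p _ q _ a b ha hb hab => conj_le fun y => ?_⟩
    have e1 := mul_le_mul_of_nonneg_left (le_conj hF p y) ha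
    have e2 := mul_le_mul_of_nonneg_left (le_conj hF q y) hb
    have : F y = a * F y + b * F y := by rw [← add_mul, hab, one_mul]
    simp only [inner_add_left, real_inner_smul_left, smul_eq_mul]
    linarith
  exact this.locallyLipschitz.continuous

lemma conj_superLin {d : ℕ} {F : (𝔼 d) → ℝ} (hF : SuperLin F) (hc : Continuous F) :
    SuperLin (legendreConj F) := by
  intro R
  have hcomp : IsCompact (Metric.closedBall (0 : 𝔼 d) |R|) := isCompact_closedBall _ _
  obtain ⟨C, hC⟩ := hcomp.bddAbove_image hc.continuousOn
  refine ⟨C, fun p => ?_⟩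
  have h1 := le_conj hF p ((R / ‖p‖) • p)
  have h2 : F ((R / ‖p‖) • p) ≤ C := by
    refine hC ⟨_, ?_, rfl⟩
    simp only [Metric.mem_closedBall, dist_zero_right, norm_smul, Real.norm_eq_abs, abs_div,
      abs_norm]
    by_cases hp : ‖p‖ = 0
    · simp [hp]
    · rw [div_mul_cancel₀ _ hp]
  have h3 : ⟪p, (R / ‖p‖) • p⟫ = R * ‖p‖ := by
    rw [real_inner_smul_right, real_inner_self_eq_norm_sq]
    by_cases hp : ‖p‖ = 0
    · simp [hp]
    · field_simp
  linarith

lemma lax_integrand_lb {d : ℕ} {F g : (𝔼 d) → ℝ} (hF : SuperLin F) (hc : Continuous F)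
    {K : NNReal} (hg : LipschitzWith K g) (x : 𝔼 d) :
    ∃ C, ∀ y, ‖x - y‖ - C ≤ legendreConj F (x - y) + g y := by
  obtain ⟨C, hC⟩ := conj_superLin hF hc (K + 1)
  refine ⟨C - g x, fun y => ?_⟩
  have h1 := hC (x - y)
  have h2 := hg.dist_le_mul x y
  rw [Real.dist_eq, dist_eq_norm] at h2
  have h3 := (abs_le.1 h2).2
  linarith

lemma lax_bdd {d : ℕ} {F g : (𝔼 d) → ℝ} (hF : SuperLin F) (hc : Continuous F)
    {K : NNReal} (hg : LipschitzWith K g) (x : 𝔼 d) :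
    BddBelow (Set.range fun y => legendreConj F (x - y) + g y) := by
  obtain ⟨C, hC⟩ := lax_integrand_lb hF hc hg x
  refine ⟨-C, ?_⟩
  rintro _ ⟨y, rfl⟩
  have := hC y
  have := norm_nonneg (x - y)
  simp only
  linarith

lemma lax_min {d : ℕ} {F g : (𝔼 d) → ℝ} (hF : SuperLin F) (hc : Continuous F)
    {K : NNReal} (hg : LipschitzWith K g) (x : 𝔼 d) :
    ∃ y, ∀ y', legendreConj F (x - y) + g y ≤ legendreConj F (x - y') + g y' := by
  have hcont : Continuous fun y => legendreConj F (x - y) + g y :=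
    ((conj_continuous hF).comp (by fun_prop)).add hg.continuous
  apply hcont.exists_forall_le
  obtain ⟨C, hC⟩ := lax_integrand_lb hF hc hg x
  refine tendsto_atTop_mono (f := fun y => ‖y‖ + (-‖x‖ - C)) (fun y => ?_) ?_
  · have := hC y
    have h := norm_sub_norm_le y x
    rw [norm_sub_rev] at h
    linarith
  · exact tendsto_atTop_add_const_right _ _ (tendsto_norm_cocompact_atTop)

lemma exists_subgrad_s7 {d : ℕ} {H : (𝔼 d) → ℝ} (hc : Continuous H)
    (hH : ConvexOn ℝ Set.univ H) (p : 𝔼 d) :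
    ∃ v : 𝔼 d, ∀ ξ, ⟪v, ξ⟫ - H ξ ≤ ⟪v, p⟫ - H p := by
  have hopen : IsOpen {q : (𝔼 d) × ℝ | q.1 ∈ Set.univ ∧ H q.1 < q.2} := by
    simp only [Set.mem_univ, true_and]
    exact isOpen_lt (by fun_prop) (by fun_prop)
  obtain ⟨f, hf⟩ := geometric_hahn_banach_open_point hH.convex_strict_epigraph hopen
    (x := (p, H p)) (by simp)
  have hsplit : ∀ q r, f (q, r) = f (q, 0) + r * f (0, 1) := by
    intro q r
    have : ((q, r) : (𝔼 d) × ℝ) = (q, 0) + r • (0, 1) := by simp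
    rw [this, map_add, map_smul, smul_eq_mul]
  have hf' : ∀ q r, H q < r → f (q, 0) + r * f (0, 1) < f (p, 0) + H p * f (0, 1) := by
    intro q r hr
    have := hf (q, r) ⟨trivial, hr⟩
    rwa [hsplit q, hsplit p] at this
  set c := f (0, 1) with hcdef
  have hc0 : c < 0 := by
    have := hf' p (H p + 1) (by linarith)
    linarith
  have hle : ∀ q, f (q, 0) + H q * c ≤ f (p, 0) + H p * c := by
    intro q
    have ht : Tendsto (fun r : ℝ => f (q, 0) + r * c) (𝓝[>] (H q)) (𝓝 (f (q, 0) + H q * c)) := by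
      have : Continuous (fun r : ℝ => f (q, 0) + r * c) := by fun_prop
      exact (this.tendsto _).mono_left nhdsWithin_le_nhds
    refine le_of_tendsto ht ?_
    filter_upwards [self_mem_nhdsWithin] with r hr
    exact (hf' q r hr).le
  let φ : StrongDual ℝ (𝔼 d) := f.comp (ContinuousLinearMap.inl ℝ (𝔼 d) ℝ)
  have hφ : ∀ q, f (q, 0) = φ q := fun q => by simp [φ]
  refine ⟨(-c)⁻¹ • (InnerProductSpace.toDual ℝ (𝔼 d)).symm φ, fun ξ => ?_⟩
  simp only [real_inner_smul_left, InnerProductSpace.toDual_symm_apply]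
  have h := hle ξ
  rw [hφ, hφ] at h
  have hcpos : 0 < -c := by linarith
  have hci : 0 < (-c)⁻¹ := inv_pos.2 hcpos
  have h2 := mul_le_mul_of_nonneg_left h hci.le
  have e : (-c)⁻¹ * c = -1 := by
    have : (-c)⁻¹ * (-c) = 1 := inv_mul_cancel₀ hcpos.ne'
    linarith
  have e1 : ∀ a b : ℝ, (-c)⁻¹ * (a + b * c) = (-c)⁻¹ * a - b := by
    intro a b
    have : (-c)⁻¹ * (a + b * c) = (-c)⁻¹ * a + b * ((-c)⁻¹ * c) := by ring
    rw [this, e]; ring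
  rw [e1, e1] at h2
  exact h2

lemma fderiv_dir_le {E : Type*} [NormedAddCommGroup E] [NormedSpace ℝ E] {W : E → ℝ}
    {L : E →L[ℝ] ℝ} {P V : E} {c : ℝ} (hW : HasFDerivAt W L P)
    (h : ∀ s : ℝ, 0 < s → s < 1 → W (P + s • V) ≤ W P + s * c) : L V ≤ c := by
  have hd : HasDerivAt (fun s : ℝ => W (P + s • V)) (L V) 0 := by
    have h1 : HasDerivAt (fun s : ℝ => P + s • V) V 0 := by
      simpa using ((hasDerivAt_id (0 : ℝ)).smul_const V).const_add P
    have hW' : HasFDerivAt W L (P + (0 : ℝ) • V) := by simpa using hW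
    exact hW'.comp_hasDerivAt (0 : ℝ) h1
  have ht := hd.tendsto_slope_zero_right
  refine le_of_tendsto ht ?_
  have : Set.Ioo (0 : ℝ) 1 ∈ 𝓝[>] (0 : ℝ) := Ioo_mem_nhdsGT one_pos
  filter_upwards [this] with s hs
  have := h s hs.1 hs.2
  simp only [zero_add, zero_smul, add_zero, smul_eq_mul]
  rw [inv_mul_le_iff₀ hs.1]
  linarith

lemma step_le {d : ℕ} {F F' H g : (𝔼 d) → ℝ} (hF : SuperLin F)
    (hF' : SuperLin F') (hc' : Continuous F') {K : NNReal} (hg : LipschitzWith K g)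
    {s : ℝ} (hs : 0 < s) (hFF : ∀ ξ, F' ξ = F ξ + s * H ξ) {v p : 𝔼 d}
    (hv : ∀ ξ, ⟪v, ξ⟫ - H ξ ≤ ⟪v, p⟫ - H p) (x : 𝔼 d) :
    (⨅ y, (legendreConj F' (x + s • v - y) + g y)) ≤
      (⨅ y, (legendreConj F (x - y) + g y)) + s * (⟪v, p⟫ - H p) := by
  rw [← sub_le_iff_le_add]
  refine le_ciInf fun y => ?_
  have h1 := ciInf_le (lax_bdd hF' hc' hg (x + s • v)) y
  have h2 : legendreConj F' (x + s • v - y) ≤ legendreConj F (x - y) + s * (⟪v, p⟫ - H p) := by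
    refine conj_le fun ξ => ?_
    have e1 := le_conj hF (x - y) ξ
    have e2 := mul_le_mul_of_nonneg_left (hv ξ) hs.le
    have e3 : x + s • v - y = (x - y) + s • v := by abel
    rw [e3, inner_add_left, real_inner_smul_left, hFF]
    linarith
  linarith

/-- At every point `(t₁,t₂,x) ∈ (0,∞)² × ℝ^d` where the multi-time Lax formula `w` is
(totally) differentiable, both multi-time Hamilton–Jacobi equations
`∂_{t₁} w + H₁(Dw) = 0` and `∂_{t₂} w + H₂(Dw) = 0` hold, `Dw` being the spatial
gradient. -/
theorem lax_solves_HJ_at_differentiability_points (d : ℕ)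
    (H₁ H₂ g : EuclideanSpace ℝ (Fin d) → ℝ)
    (hH₁ : ConvexOn ℝ Set.univ H₁) (hH₂ : ConvexOn ℝ Set.univ H₂)
    (hH₁coer : Coercive H₁) (hH₂coer : Coercive H₂)
    (K : NNReal) (hg : LipschitzWith K g)
    (t₁ t₂ : ℝ) (ht₁ : 0 < t₁) (ht₂ : 0 < t₂) (x : EuclideanSpace ℝ (Fin d))
    (hdiff : DifferentiableAt ℝ
      (fun p : ℝ × ℝ × EuclideanSpace ℝ (Fin d) => lax H₁ H₂ g p.1 p.2.1 p.2.2) (t₁, t₂, x)) :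
    deriv (fun s => lax H₁ H₂ g s t₂ x) t₁
        + H₁ (gradient (fun x' => lax H₁ H₂ g t₁ t₂ x') x) = 0 ∧
    deriv (fun s => lax H₁ H₂ g t₁ s x) t₂
        + H₂ (gradient (fun x' => lax H₁ H₂ g t₁ t₂ x') x) = 0 := by
  have hc₁ : Continuous H₁ := hH₁.locallyLipschitz.continuous
  have hc₂ : Continuous H₂ := hH₂.locallyLipschitz.continuous
  have hs₁ := superLin_of_coercive hc₁ hH₁coer
  have hs₂ := superLin_of_coercive hc₂ hH₂coer
  obtain ⟨L, hL⟩ := hdiff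
  have d1 : deriv (fun s => lax H₁ H₂ g s t₂ x) t₁ = L (1, 0, 0) := by
    have h1 : HasDerivAt (fun s : ℝ => (s, t₂, x)) ((1 : ℝ), (0 : ℝ), (0 : 𝔼 d)) t₁ :=
      (hasDerivAt_id t₁).prodMk (hasDerivAt_const t₁ (t₂, x))
    exact (HasFDerivAt.comp_hasDerivAt t₁ hL h1).deriv
  have d2 : deriv (fun s => lax H₁ H₂ g t₁ s x) t₂ = L (0, 1, 0) := by
    have h1 : HasDerivAt (fun s : ℝ => (t₁, s, x)) ((0 : ℝ), (1 : ℝ), (0 : 𝔼 d)) t₂ :=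
      (hasDerivAt_const t₂ t₁).prodMk ((hasDerivAt_id t₂).prodMk (hasDerivAt_const t₂ x))
    exact (HasFDerivAt.comp_hasDerivAt t₂ hL h1).deriv
  have d3 : ∀ v, ⟪v, gradient (fun x' => lax H₁ H₂ g t₁ t₂ x') x⟫ = L (0, 0, v) := by
    intro v
    have h1 : HasFDerivAt (fun x' : 𝔼 d => (t₁, t₂, x'))
        ((0 : (𝔼 d) →L[ℝ] ℝ).prod ((0 : (𝔼 d) →L[ℝ] ℝ).prod (ContinuousLinearMap.id ℝ (𝔼 d)))) x :=
      (hasFDerivAt_const t₁ x).prodMk ((hasFDerivAt_const t₂ x).prodMk (hasFDerivAt_id x))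
    have h2 := (HasFDerivAt.comp x hL h1).hasGradientAt.gradient
    have h3 : gradient (fun x' => lax H₁ H₂ g t₁ t₂ x') x = _ := h2
    rw [h3, real_inner_comm, InnerProductSpace.toDual_symm_apply]
    simp
  set p := gradient (fun x' => lax H₁ H₂ g t₁ t₂ x') x with hp
  rw [d1, d2]
  have hsplit : ∀ a b v, L (a, b, v) = a * L (1, 0, 0) + b * L (0, 1, 0) + L (0, 0, v) := by
    intro a b v
    have : ((a, b, v) : ℝ × ℝ × 𝔼 d) = a • (1, 0, 0) + b • (0, 1, 0) + (0, 0, v) := by simp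
    rw [this, map_add, map_add, map_smul, map_smul, smul_eq_mul, smul_eq_mul]
  have hFc : ∀ a b : ℝ, Continuous fun ξ => a * H₁ ξ + b * H₂ ξ := fun a b => by fun_prop
  -- subsolution inequalities
  have le1 : L (1, 0, 0) + H₁ p ≤ 0 := by
    obtain ⟨v, hv⟩ := exists_subgrad_s7 hc₁ hH₁ p
    have := fderiv_dir_le (V := (1, 0, v)) (c := ⟪v, p⟫ - H₁ p) hL (fun s hs _ => by
      have := step_le (superLin_comb hs₁ hs₂ ht₁ ht₂)
        (superLin_comb hs₁ hs₂ (add_pos ht₁ hs) ht₂) (hFc _ _) hg hs (fun ξ => by ring) hv x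
      simpa [lax] using this)
    rw [hsplit, ← d3] at this
    linarith
  have le2 : L (0, 1, 0) + H₂ p ≤ 0 := by
    obtain ⟨v, hv⟩ := exists_subgrad_s7 hc₂ hH₂ p
    have := fderiv_dir_le (V := (0, 1, v)) (c := ⟪v, p⟫ - H₂ p) hL (fun s hs _ => by
      have := step_le (superLin_comb hs₁ hs₂ ht₁ ht₂)
        (superLin_comb hs₁ hs₂ ht₁ (add_pos ht₂ hs)) (hFc _ _) hg hs (fun ξ => by ring) hv x
      simpa [lax] using this)
    rw [hsplit, ← d3] at this
    linarith
  -- supersolution inequality, by scaling towards the foot of an optimal ray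
  have hF := superLin_comb hs₁ hs₂ ht₁ ht₂
  obtain ⟨y, hy⟩ := lax_min hF (hFc _ _) hg x
  have hw : legendreConj (fun ξ => t₁ * H₁ ξ + t₂ * H₂ ξ) (x - y) + g y ≤ lax H₁ H₂ g t₁ t₂ x :=
    le_ciInf hy
  have key := fderiv_dir_le (V := (-t₁, -t₂, -(x - y)))
    (c := - legendreConj (fun ξ => t₁ * H₁ ξ + t₂ * H₂ ξ) (x - y)) hL (fun s hs hs1 => by
      have p1 : 0 < t₁ + s * -t₁ := by nlinarith
      have p2 : 0 < t₂ + s * -t₂ := by nlinarith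
      have h1 := ciInf_le (lax_bdd (superLin_comb hs₁ hs₂ p1 p2) (hFc _ _) hg
        (x + s • -(x - y))) y
      have h2 : legendreConj (fun ξ => (t₁ + s * -t₁) * H₁ ξ + (t₂ + s * -t₂) * H₂ ξ)
          (x + s • -(x - y) - y) ≤
          (1 - s) * legendreConj (fun ξ => t₁ * H₁ ξ + t₂ * H₂ ξ) (x - y) := by
        refine conj_le fun ξ => ?_
        have e1 := mul_le_mul_of_nonneg_left (le_conj hF (x - y) ξ) (sub_pos.2 hs1).le
        have e3 : x + s • -(x - y) - y = (1 - s) • (x - y) := by module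
        rw [e3, real_inner_smul_left]
        linarith
      change lax H₁ H₂ g (t₁ + s * -t₁) (t₂ + s * -t₂) (x + s • -(x - y)) ≤
        lax H₁ H₂ g t₁ t₂ x + _
      change lax H₁ H₂ g (t₁ + s * -t₁) (t₂ + s * -t₂) (x + s • -(x - y)) ≤ _ at h1
      linarith)
  have h3 := le_conj hF (x - y) p
  rw [hsplit, ← d3, inner_neg_left] at key
  have h4 : 0 ≤ t₁ * (L (1, 0, 0) + H₁ p) + t₂ * (L (0, 1, 0) + H₂ p) := by linarith
  constructor
  · nlinarith
  · nlinarith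
end

section
/- Assume g : ℝ^d → ℝ is bounded and Lipschitz continuous and H₁, H₂ : ℝ^d → ℝ are convex and coercive. Then there is at most one Lipschitz continuous and bounded viscosity solution of the multi-time Hamilton–Jacobi system ∂_{t₁} w + H₁(Dw) = 0, ∂_{t₂} w + H₂(Dw) = 0 on (0,∞)² × ℝ^d with w(0,0,·) = g: if w and w̃ are two such solutions, then w = w̃ everywhere on [0,∞)² × ℝ^d. -/
open Filter Topology
open scoped RealInnerProductSpace

/-- The open region `(0,∞)² × ℝ^d`. -/
def posTimes (d : ℕ) : Set (ℝ × ℝ × EuclideanSpace ℝ (Fin d)) :=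
  {p | 0 < p.1 ∧ 0 < p.2.1}

/-- `W` is a viscosity subsolution of the multi-time Hamilton–Jacobi system
`∂_{t₁} w + H₁(Dw) = 0`, `∂_{t₂} w + H₂(Dw) = 0` on `(0,∞)² × ℝ^d` with initial
datum `g`. -/
def IsViscositySubsolution {d : ℕ} (H₁ H₂ g : EuclideanSpace ℝ (Fin d) → ℝ)
    (W : ℝ × ℝ × EuclideanSpace ℝ (Fin d) → ℝ) : Prop :=
  ContinuousOn W (posTimes d) ∧ (∀ x, W (0, 0, x) = g x) ∧
  ∀ φ : ℝ × ℝ × EuclideanSpace ℝ (Fin d) → ℝ, ContDiffOn ℝ 1 φ (posTimes d) →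
    ∀ (τ₁ τ₂ : ℝ) (ξ : EuclideanSpace ℝ (Fin d)), 0 < τ₁ → 0 < τ₂ →
      IsLocalMaxOn (fun p => W p - φ p) (posTimes d) (τ₁, τ₂, ξ) →
      deriv (fun s => φ (s, τ₂, ξ)) τ₁ + H₁ (gradient (fun x' => φ (τ₁, τ₂, x')) ξ) ≤ 0 ∧
      deriv (fun s => φ (τ₁, s, ξ)) τ₂ + H₂ (gradient (fun x' => φ (τ₁, τ₂, x')) ξ) ≤ 0

/-- `W` is a viscosity supersolution of the multi-time Hamilton–Jacobi system. -/
def IsViscositySupersolution {d : ℕ} (H₁ H₂ g : EuclideanSpace ℝ (Fin d) → ℝ)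
    (W : ℝ × ℝ × EuclideanSpace ℝ (Fin d) → ℝ) : Prop :=
  ContinuousOn W (posTimes d) ∧ (∀ x, W (0, 0, x) = g x) ∧
  ∀ φ : ℝ × ℝ × EuclideanSpace ℝ (Fin d) → ℝ, ContDiffOn ℝ 1 φ (posTimes d) →
    ∀ (τ₁ τ₂ : ℝ) (ξ : EuclideanSpace ℝ (Fin d)), 0 < τ₁ → 0 < τ₂ →
      IsLocalMinOn (fun p => W p - φ p) (posTimes d) (τ₁, τ₂, ξ) →
      0 ≤ deriv (fun s => φ (s, τ₂, ξ)) τ₁ + H₁ (gradient (fun x' => φ (τ₁, τ₂, x')) ξ) ∧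
      0 ≤ deriv (fun s => φ (τ₁, s, ξ)) τ₂ + H₂ (gradient (fun x' => φ (τ₁, τ₂, x')) ξ)

lemma grad_quad {d : ℕ} (c a b : ℝ) (y ξ : EuclideanSpace ℝ (Fin d)) (f : EuclideanSpace ℝ (Fin d) → ℝ)
    (hf : ∀ x, f x = a * ‖x - y‖ ^ 2 + b * ‖x‖ ^ 2 + c) :
    gradient f ξ = (2 * a) • (ξ - y) + (2 * b) • ξ := by
  have hf' : f = fun x => a * ‖x - y‖ ^ 2 + b * ‖x‖ ^ 2 + c := funext hf
  subst hf'
  apply HasGradientAt.gradient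
  rw [hasGradientAt_iff_hasFDerivAt]
  have h1 := ((hasFDerivAt_id (𝕜 := ℝ) ξ).sub_const y).norm_sq.const_mul a
  have h2 := (hasFDerivAt_id (𝕜 := ℝ) ξ).norm_sq.const_mul b
  have h3 := (h1.add h2).add_const c
  refine h3.congr_fderiv ?_
  ext v
  simp [inner_add_left, inner_smul_left]
  ring

lemma bdd_of_sq {a b : ℝ} (h : a ^ 2 ≤ b) : |a| ≤ b + 1 := by
  rw [abs_le]; constructor <;> nlinarith [sq_nonneg (a - 1), sq_nonneg (a + 1)]

/-- the doubled function -/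
noncomputable def Phi {d : ℕ} (w w' : ℝ × ℝ × EuclideanSpace ℝ (Fin d) → ℝ) (A l δ T₁ T₂ : ℝ)
    (z : (ℝ × ℝ × EuclideanSpace ℝ (Fin d)) × (ℝ × ℝ × EuclideanSpace ℝ (Fin d))) : ℝ :=
  w z.1 - w' z.2 - (A * ((z.1.1 - z.2.1) ^ 2 + (z.1.2.1 - z.2.2.1) ^ 2 + ‖z.1.2.2 - z.2.2.2‖ ^ 2
    + (z.1.1 / T₁ - z.1.2.1 / T₂) ^ 2) + l * (z.1.1 / T₁) + δ * ‖z.1.2.2‖ ^ 2)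

lemma exists_max {d : ℕ} (w w' : ℝ × ℝ × EuclideanSpace ℝ (Fin d) → ℝ) (A l δ T₁ T₂ M : ℝ)
    (hA : 0 < A) (hl : 0 < l) (hδ : 0 < δ) (hT₁ : 0 < T₁) (hT₂ : 0 < T₂)
    (hM : ∀ p q, w p - w' q ≤ M)
    (hw : ContinuousOn w {p | 0 ≤ p.1 ∧ 0 ≤ p.2.1})
    (hw' : ContinuousOn w' {p | 0 ≤ p.1 ∧ 0 ≤ p.2.1})
    (z₀ : (ℝ × ℝ × EuclideanSpace ℝ (Fin d)) × (ℝ × ℝ × EuclideanSpace ℝ (Fin d)))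
    (hz₀ : (0 ≤ z₀.1.1 ∧ 0 ≤ z₀.1.2.1) ∧ (0 ≤ z₀.2.1 ∧ 0 ≤ z₀.2.2.1))
    (hpos : 0 ≤ Phi w w' A l δ T₁ T₂ z₀) :
    ∃ z : (ℝ × ℝ × EuclideanSpace ℝ (Fin d)) × (ℝ × ℝ × EuclideanSpace ℝ (Fin d)),
      ((0 ≤ z.1.1 ∧ 0 ≤ z.1.2.1) ∧ (0 ≤ z.2.1 ∧ 0 ≤ z.2.2.1)) ∧
      ∀ z' : (ℝ × ℝ × EuclideanSpace ℝ (Fin d)) × (ℝ × ℝ × EuclideanSpace ℝ (Fin d)),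
        ((0 ≤ z'.1.1 ∧ 0 ≤ z'.1.2.1) ∧ (0 ≤ z'.2.1 ∧ 0 ≤ z'.2.2.1)) →
        Phi w w' A l δ T₁ T₂ z' ≤ Phi w w' A l δ T₁ T₂ z := by
  set S : Set ((ℝ × ℝ × EuclideanSpace ℝ (Fin d)) × (ℝ × ℝ × EuclideanSpace ℝ (Fin d))) :=
    {z | (0 ≤ z.1.1 ∧ 0 ≤ z.1.2.1) ∧ (0 ≤ z.2.1 ∧ 0 ≤ z.2.2.1)} with hS
  have hSc : IsClosed S := by
    simp only [hS, Set.setOf_and]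
    refine IsClosed.inter (IsClosed.inter ?_ ?_) (IsClosed.inter ?_ ?_)
    · exact isClosed_le continuous_const (continuous_fst.comp continuous_fst)
    · exact isClosed_le continuous_const (continuous_fst.comp (continuous_snd.comp continuous_fst))
    · exact isClosed_le continuous_const (continuous_fst.comp continuous_snd)
    · exact isClosed_le continuous_const (continuous_fst.comp (continuous_snd.comp continuous_snd))
  have hcont : ContinuousOn (Phi w w' A l δ T₁ T₂) S := by
    unfold Phi
    refine ContinuousOn.sub (ContinuousOn.sub ?_ ?_) ?_
    · exact hw.comp continuousOn_fst (fun z hz => hz.1)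
    · exact hw'.comp continuousOn_snd (fun z hz => hz.2)
    · fun_prop
  obtain ⟨R, hR⟩ : ∃ R : ℝ, ∀ z ∈ S, 0 ≤ Phi w w' A l δ T₁ T₂ z → ‖z‖ ≤ R := by
    set a := M / A + 1 with ha
    set b := M / δ + 1 with hb
    set c := T₁ * (M / l) with hc
    set e := T₂ * (M / l + a) with he
    refine ⟨max (max c (max e b)) (max (c + a) (max (e + a) (b + a))), fun z hz h0 => ?_⟩
    obtain ⟨⟨t1, t2, x⟩, ⟨s1, s2, y⟩⟩ := z
    obtain ⟨⟨h1, h2⟩, h3, h4⟩ := hz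
    simp only [Phi] at h0 h1 h2 h3 h4
    have hm := hM (t1, t2, x) (s1, s2, y)
    have p1 : 0 ≤ A * (t1 - s1) ^ 2 := by positivity
    have p2 : 0 ≤ A * (t2 - s2) ^ 2 := by positivity
    have p3 : 0 ≤ A * ‖x - y‖ ^ 2 := by positivity
    have p4 : 0 ≤ A * (t1 / T₁ - t2 / T₂) ^ 2 := by positivity
    have p5 : 0 ≤ l * (t1 / T₁) := by positivity
    have p6 : 0 ≤ δ * ‖x‖ ^ 2 := by positivity
    have q1 : |t1 - s1| ≤ a := bdd_of_sq (by rw [le_div_iff₀ hA]; linarith)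
    have q2 : |t2 - s2| ≤ a := bdd_of_sq (by rw [le_div_iff₀ hA]; linarith)
    have q3 : |‖x - y‖| ≤ a := bdd_of_sq (by rw [le_div_iff₀ hA]; linarith)
    have q4 : |t1 / T₁ - t2 / T₂| ≤ a := bdd_of_sq (by rw [le_div_iff₀ hA]; linarith)
    have q5 : t1 / T₁ ≤ M / l := by rw [le_div_iff₀ hl]; linarith
    have q6 : |‖x‖| ≤ b := bdd_of_sq (by rw [le_div_iff₀ hδ]; linarith)
    rw [abs_norm] at q3 q6
    rw [abs_le] at q1 q2 q4
    have r1 : t1 ≤ c := by rw [div_le_iff₀ hT₁] at q5; linarith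
    have r2 : t2 ≤ e := by
      have : t2 / T₂ ≤ M / l + a := by linarith
      rw [div_le_iff₀ hT₂] at this; linarith
    have r3 : ‖y‖ ≤ b + a := by
      have := norm_sub_norm_le y x
      rw [norm_sub_rev] at this; linarith
    simp only [Prod.norm_def, Real.norm_eq_abs, abs_of_nonneg h1, abs_of_nonneg h2,
      abs_of_nonneg h3, abs_of_nonneg h4]
    gcongr <;> linarith
  obtain ⟨z, hz, hmax⟩ := ((isCompact_closedBall (0 : (ℝ × ℝ × EuclideanSpace ℝ (Fin d)) × (ℝ × ℝ × EuclideanSpace ℝ (Fin d))) R).inter_left hSc).exists_isMaxOn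
    ⟨z₀, hz₀, by simpa using hR z₀ hz₀ hpos⟩ (hcont.mono Set.inter_subset_left)
  refine ⟨z, hz.1, fun z' hz' => ?_⟩
  have hb : Phi w w' A l δ T₁ T₂ z₀ ≤ Phi w w' A l δ T₁ T₂ z :=
    hmax ⟨hz₀, by simpa using hR z₀ hz₀ hpos⟩
  by_cases h : 0 ≤ Phi w w' A l δ T₁ T₂ z'
  · exact hmax ⟨hz', by simpa using hR z' hz' h⟩
  · linarith

lemma unif {d : ℕ} (H : EuclideanSpace ℝ (Fin d) → ℝ) (hH : Continuous H) (R l : ℝ) (hl : 0 < l) :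
    ∃ η > 0, ∀ p v : EuclideanSpace ℝ (Fin d), ‖p‖ ≤ R → ‖v‖ < η → |H p - H (p + v)| < l := by
  have huc := (isCompact_closedBall (0 : EuclideanSpace ℝ (Fin d)) (R + 1)).uniformContinuousOn_of_continuous
    hH.continuousOn
  rw [Metric.uniformContinuousOn_iff] at huc
  obtain ⟨η, hη, h⟩ := huc l hl
  refine ⟨min η 1, by positivity, fun p v hp hv => ?_⟩
  have hv1 := hv.trans_le (min_le_left _ _)
  have hv2 := hv.trans_le (min_le_right _ _)
  have := h p (by simp; linarith) (p + v) (by simp; linarith [norm_add_le p v]) (by simpa [dist_eq_norm] using hv1)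
  simpa [Real.dist_eq] using this

set_option maxHeartbeats 1600000 in
lemma comparison {d : ℕ} (H₁ H₂ g : EuclideanSpace ℝ (Fin d) → ℝ)
    (hH₁ : Continuous H₁) (hH₂ : Continuous H₂)
    (K : NNReal) (hg : LipschitzWith K g)
    (w w' : ℝ × ℝ × EuclideanSpace ℝ (Fin d) → ℝ)
    (L L' : NNReal)
    (hwlip : LipschitzOnWith L w {p : ℝ × ℝ × EuclideanSpace ℝ (Fin d) | 0 ≤ p.1 ∧ 0 ≤ p.2.1})
    (hw'lip : LipschitzOnWith L' w' {p : ℝ × ℝ × EuclideanSpace ℝ (Fin d) | 0 ≤ p.1 ∧ 0 ≤ p.2.1})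
    (M : ℝ) (hM : ∀ p q, w p - w' q ≤ M)
    (hw : IsViscositySubsolution H₁ H₂ g w) (hw' : IsViscositySupersolution H₁ H₂ g w')
    (T₁ T₂ : ℝ) (x₀ : EuclideanSpace ℝ (Fin d)) (hT₁ : 0 < T₁) (hT₂ : 0 < T₂) :
    w (T₁, T₂, x₀) ≤ w' (T₁, T₂, x₀) := by
  by_contra hcon
  push Not at hcon
  set θ := w (T₁, T₂, x₀) - w' (T₁, T₂, x₀) with hθ
  have hθ0 : 0 < θ := by linarith
  have hM0 : 0 < M := lt_of_lt_of_le hθ0 (hM _ _)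
  set l := θ / 4 with hl
  have hl0 : 0 < l := by positivity
  obtain ⟨η₁, hη₁, hu₁⟩ := unif H₁ hH₁ (2 * L') (l / (2 * T₁)) (by positivity)
  obtain ⟨η₂, hη₂, hu₂⟩ := unif H₂ hH₂ (2 * L') (l / (2 * T₂)) (by positivity)
  -- choice of δ
  obtain ⟨η, hη, hηη₁, hηη₂⟩ : ∃ η > 0, η ≤ η₁ ∧ η ≤ η₂ :=
    ⟨min η₁ η₂, by positivity, min_le_left _ _, min_le_right _ _⟩
  obtain ⟨δ, hδ, hδ1, hδ2⟩ : ∃ δ > 0, δ * ‖x₀‖ ^ 2 ≤ θ / 4 ∧ 4 * δ * M < η ^ 2 := by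
    refine ⟨min (θ / 4 / (‖x₀‖ ^ 2 + 1)) (η ^ 2 / (8 * M)), by positivity, ?_, ?_⟩
    · calc _ ≤ θ / 4 / (‖x₀‖ ^ 2 + 1) * (‖x₀‖ ^ 2 + 1) := by
            gcongr
            · exact min_le_left _ _
            · linarith
        _ = θ / 4 := by field_simp
    · calc _ ≤ 4 * (η ^ 2 / (8 * M)) * M := by
            gcongr
            exact min_le_right _ _
        _ = η ^ 2 / 2 := by field_simp; norm_num
        _ < η ^ 2 := by linarith [pow_pos hη 2]
  -- choice of κ, A
  set B := 1 + T₂ * (1 / T₁ + 1) + T₁ * (1 / T₂ + 1) with hB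
  have hB1 : 1 ≤ B := by
    have : 0 ≤ T₂ * (1 / T₁ + 1) := by positivity
    have : 0 ≤ T₁ * (1 / T₂ + 1) := by positivity
    linarith
  obtain ⟨κ, hκ, hκ1⟩ : ∃ κ > 0, ((L : ℝ) + L' + K) * ((B + 1) * κ) < θ / 2 := by
    refine ⟨θ / 2 / (((L : ℝ) + L' + K + 1) * (B + 1)), by positivity, ?_⟩
    have : ((L : ℝ) + L' + K + 1) * ((B + 1) * (θ / 2 / (((L : ℝ) + L' + K + 1) * (B + 1)))) = θ / 2 := by
      field_simp
    have h2 : 0 < (B + 1) * (θ / 2 / (((L : ℝ) + L' + K + 1) * (B + 1))) := by positivity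
    linarith
  obtain ⟨A, hA, hA1, hA2⟩ : ∃ A > 0, (L' : ℝ) ≤ A * κ ∧ M ≤ A * κ ^ 2 := by
    refine ⟨(L' : ℝ) / κ + M / κ ^ 2, by positivity, ?_, ?_⟩
    · have : 0 ≤ M / κ ^ 2 * κ := by positivity
      have h2 : (L' : ℝ) / κ * κ = L' := by field_simp
      linarith
    · have : 0 ≤ (L' : ℝ) / κ * κ ^ 2 := by positivity
      have h2 : M / κ ^ 2 * κ ^ 2 = M := by field_simp
      linarith
  have hz0 : θ / 2 ≤ Phi w w' A l δ T₁ T₂ ((T₁, T₂, x₀), (T₁, T₂, x₀)) := by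
    simp only [Phi, sub_self, norm_zero, div_self hT₁.ne', div_self hT₂.ne']
    rw [← hθ]
    norm_num
    linarith
  obtain ⟨⟨⟨t1, t2, x⟩, ⟨s1, s2, y⟩⟩, ⟨⟨ht1, ht2⟩, hs1, hs2⟩, hmax⟩ := exists_max w w' A l δ T₁ T₂ M hA hl0 hδ hT₁ hT₂ hM
    hwlip.continuousOn hw'lip.continuousOn ((T₁, T₂, x₀), (T₁, T₂, x₀))
    ⟨⟨hT₁.le, hT₂.le⟩, hT₁.le, hT₂.le⟩ (by linarith)
  simp only at ht1 ht2 hs1 hs2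
  have hbase := hmax ((T₁, T₂, x₀), (T₁, T₂, x₀)) ⟨⟨hT₁.le, hT₂.le⟩, hT₁.le, hT₂.le⟩
  have hdiag := hmax ((t1, t2, x), (t1, t2, x)) ⟨⟨ht1, ht2⟩, ht1, ht2⟩
  have hP : θ / 2 ≤ Phi w w' A l δ T₁ T₂ ((t1, t2, x), (s1, s2, y)) := hz0.trans hbase
  clear hbase hz0
  simp only [Phi] at hP hdiag
  have hm := hM (t1, t2, x) (s1, s2, y)
  have p1 : 0 ≤ A * (t1 - s1) ^ 2 := by positivity
  have p2 : 0 ≤ A * (t2 - s2) ^ 2 := by positivity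
  have p3 : 0 ≤ A * ‖x - y‖ ^ 2 := by positivity
  have p4 : 0 ≤ A * (t1 / T₁ - t2 / T₂) ^ 2 := by positivity
  have p5 : 0 ≤ l * (t1 / T₁) := by positivity
  have p6 : 0 ≤ δ * ‖x‖ ^ 2 := by positivity
  -- distance bound
  set D := dist ((t1, t2, x) : ℝ × ℝ × EuclideanSpace ℝ (Fin d)) (s1, s2, y) with hD
  have hDeq : D = max |t1 - s1| (max |t2 - s2| ‖x - y‖) := by
    simp [hD, Prod.dist_eq, Real.dist_eq, dist_eq_norm]
  have hD0 : 0 ≤ D := dist_nonneg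
  have hLD : w' (t1, t2, x) - w' (s1, s2, y) ≤ L' * D := by
    have := hw'lip.dist_le_mul (t1, t2, x) ⟨ht1, ht2⟩ (s1, s2, y) ⟨hs1, hs2⟩
    rw [Real.dist_eq] at this
    exact (le_abs_self _).trans this
  have hsum : A * D ^ 2 ≤ A * (t1 - s1) ^ 2 + A * (t2 - s2) ^ 2 + A * ‖x - y‖ ^ 2 := by
    rw [hDeq]
    rcases max_cases |t1 - s1| (max |t2 - s2| ‖x - y‖) with ⟨h, -⟩ | ⟨h, -⟩
    · rw [h, sq_abs]; linarith
    · rw [h]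
      rcases max_cases |t2 - s2| ‖x - y‖ with ⟨h, -⟩ | ⟨h, -⟩
      · rw [h, sq_abs]; linarith
      · rw [h]; linarith
  have hAD : A * D ≤ L' := by
    simp only [sub_self, norm_zero] at hdiag
    have h1 : A * D ^ 2 ≤ L' * D := by linarith
    rcases hD0.eq_or_lt with h | h
    · rw [← h]; simp
    · by_contra hc
      push Not at hc
      have h2 := mul_lt_mul_of_pos_right hc h
      have h3 : A * D ^ 2 = A * D * D := by ring
      linarith
  have hDκ : D ≤ κ := by
    have : A * D ≤ A * κ := hAD.trans hA1
    exact le_of_mul_le_mul_left this hA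
  have hd1 : |t1 - s1| ≤ D := by rw [hDeq]; exact le_max_left _ _
  have hd2 : |t2 - s2| ≤ D := by rw [hDeq]; exact (le_max_left _ _).trans (le_max_right _ _)
  have hd3 : ‖x - y‖ ≤ D := by rw [hDeq]; exact (le_max_right _ _).trans (le_max_right _ _)
  have hα : |t1 / T₁ - t2 / T₂| ≤ κ := by
    apply abs_le_of_sq_le_sq _ hκ.le
    refine le_of_mul_le_mul_left ?_ hA
    linarith
  by_cases hint : 0 < t1 ∧ 0 < t2 ∧ 0 < s1 ∧ 0 < s2
  · obtain ⟨it1, it2, is1, is2⟩ := hint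
    have hsub := hw.2.2 (fun p => A * ((p.1 - s1) ^ 2 + (p.2.1 - s2) ^ 2 + ‖p.2.2 - y‖ ^ 2
        + (p.1 / T₁ - p.2.1 / T₂) ^ 2) + l * (p.1 / T₁) + δ * ‖p.2.2‖ ^ 2) ?_ t1 t2 x it1 it2 ?_
    rotate_left
    · apply ContDiff.contDiffOn
      have e1 : ContDiff ℝ 1 (fun p : ℝ × ℝ × EuclideanSpace ℝ (Fin d) => ‖p.2.2 - y‖ ^ 2) :=
        ContDiff.norm_sq ℝ (by fun_prop)
      have e2 : ContDiff ℝ 1 (fun p : ℝ × ℝ × EuclideanSpace ℝ (Fin d) => ‖p.2.2‖ ^ 2) :=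
        ContDiff.norm_sq ℝ (by fun_prop)
      fun_prop
    · refine IsMaxOn.localize fun p hp => ?_
      have := hmax (p, (s1, s2, y)) ⟨⟨hp.1.le, hp.2.le⟩, hs1, hs2⟩
      simp only [Phi] at this
      simp only [Set.mem_setOf_eq]
      linarith
    have hsup := hw'.2.2 (fun p => -A * ((p.1 - t1) ^ 2 + (p.2.1 - t2) ^ 2 + ‖p.2.2 - x‖ ^ 2))
      ?_ s1 s2 y is1 is2 ?_
    rotate_left
    · apply ContDiff.contDiffOn
      have e1 : ContDiff ℝ 1 (fun p : ℝ × ℝ × EuclideanSpace ℝ (Fin d) => ‖p.2.2 - x‖ ^ 2) :=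
        ContDiff.norm_sq ℝ (by fun_prop)
      fun_prop
    · refine IsMinOn.localize fun p hp => ?_
      have := hmax ((t1, t2, x), p) ⟨⟨ht1, ht2⟩, hp.1.le, hp.2.le⟩
      simp only [Phi] at this
      simp only [Set.mem_setOf_eq]
      rw [norm_sub_rev p.2.2 x, norm_sub_rev y x]
      linarith
    simp only at hsub hsup
    rw [grad_quad (A * ((t1 - s1) ^ 2 + (t2 - s2) ^ 2 + (t1 / T₁ - t2 / T₂) ^ 2) + l * (t1 / T₁))
      A δ y x _ (fun z => by ring)] at hsub
    rw [grad_quad (-A * ((s1 - t1) ^ 2 + (s2 - t2) ^ 2))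
      (-A) 0 x y _ (fun z => by ring)] at hsup
    have d1 : HasDerivAt (fun s => A * ((s - s1) ^ 2 + (t2 - s2) ^ 2 + ‖x - y‖ ^ 2
        + (s / T₁ - t2 / T₂) ^ 2) + l * (s / T₁) + δ * ‖x‖ ^ 2)
        (2 * A * (t1 - s1) + 2 * A * (t1 / T₁ - t2 / T₂) / T₁ + l / T₁) t1 := by
      have a1 := ((hasDerivAt_id t1).sub_const s1).pow 2
      have a2 := (((hasDerivAt_id t1).div_const T₁).sub_const (t2 / T₂)).pow 2
      have a3 := ((hasDerivAt_id t1).div_const T₁).const_mul l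
      have := ((((((a1.add_const ((t2 - s2) ^ 2)).add_const (‖x - y‖ ^ 2)).add a2).const_mul A).add a3).add_const
        (δ * ‖x‖ ^ 2))
      refine this.congr_deriv ?_
      simp
      ring
    have d2 : HasDerivAt (fun s => A * ((t1 - s1) ^ 2 + (s - s2) ^ 2 + ‖x - y‖ ^ 2
        + (t1 / T₁ - s / T₂) ^ 2) + l * (t1 / T₁) + δ * ‖x‖ ^ 2)
        (2 * A * (t2 - s2) - 2 * A * (t1 / T₁ - t2 / T₂) / T₂) t2 := by
      have a1 := ((hasDerivAt_id t2).sub_const s2).pow 2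
      have a2 := (((hasDerivAt_id t2).div_const T₂).const_sub (t1 / T₁)).pow 2
      have := ((((((a1.const_add ((t1 - s1) ^ 2)).add_const (‖x - y‖ ^ 2)).add a2).const_mul A).add_const
        (l * (t1 / T₁))).add_const (δ * ‖x‖ ^ 2))
      refine this.congr_deriv ?_
      simp
      ring
    have d3 : HasDerivAt (fun s => -A * ((s - t1) ^ 2 + (s2 - t2) ^ 2 + ‖y - x‖ ^ 2))
        (2 * A * (t1 - s1)) s1 := by
      have a1 := ((hasDerivAt_id s1).sub_const t1).pow 2
      have := ((a1.add_const ((s2 - t2) ^ 2)).add_const (‖y - x‖ ^ 2)).const_mul (-A)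
      refine this.congr_deriv ?_
      simp
      ring
    have d4 : HasDerivAt (fun s => -A * ((s1 - t1) ^ 2 + (s - t2) ^ 2 + ‖y - x‖ ^ 2))
        (2 * A * (t2 - s2)) s2 := by
      have a1 := ((hasDerivAt_id s2).sub_const t2).pow 2
      have := ((a1.const_add ((s1 - t1) ^ 2)).add_const (‖y - x‖ ^ 2)).const_mul (-A)
      refine this.congr_deriv ?_
      simp
      ring
    rw [d1.deriv, d2.deriv] at hsub
    rw [d3.deriv, d4.deriv] at hsup
    set p := (2 * A) • (x - y) with hp
    set v := (2 * δ) • x with hv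
    have hpp : (2 * -A) • (y - x) + (2 * (0 : ℝ)) • y = p := by
      rw [hp, mul_neg, neg_smul, ← smul_neg, neg_sub]; simp
    rw [hpp] at hsup
    have hpn : ‖p‖ ≤ 2 * L' := by
      rw [hp, norm_smul, Real.norm_eq_abs, abs_of_pos (by positivity)]
      have : A * ‖x - y‖ ≤ A * D := by gcongr
      linarith
    have hvn : ‖v‖ < η := by
      rw [hv, norm_smul, Real.norm_eq_abs, abs_of_pos (by positivity)]
      apply lt_of_pow_lt_pow_left₀ 2 hη.le
      have h1 : δ * ‖x‖ ^ 2 ≤ M := by linarith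
      calc (2 * δ * ‖x‖) ^ 2 = 4 * δ * (δ * ‖x‖ ^ 2) := by ring
        _ ≤ 4 * δ * M := by gcongr
        _ < η ^ 2 := hδ2
    have k1 := (abs_lt.1 (hu₁ p v hpn (hvn.trans_le hηη₁))).2
    have k2 := (abs_lt.1 (hu₂ p v hpn (hvn.trans_le hηη₂))).2
    rw [lt_div_iff₀ (by positivity)] at k1 k2
    obtain ⟨b1, b2⟩ := hsub
    obtain ⟨c1, c2⟩ := hsup
    have m1 := mul_le_mul_of_nonneg_left b1 hT₁.le
    have m2 := mul_le_mul_of_nonneg_left b2 hT₂.le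
    have m3 := mul_le_mul_of_nonneg_left c1 hT₁.le
    have m4 := mul_le_mul_of_nonneg_left c2 hT₂.le
    have f1 : T₁ * (2 * A * (t1 - s1) + 2 * A * (t1 / T₁ - t2 / T₂) / T₁ + l / T₁ + H₁ (p + v))
      = T₁ * (2 * A * (t1 - s1)) + 2 * A * (t1 / T₁ - t2 / T₂) + l + T₁ * H₁ (p + v) := by
      have g1 : T₁ * (2 * A * (t1 / T₁ - t2 / T₂) / T₁) = 2 * A * (t1 / T₁ - t2 / T₂) :=
        mul_div_cancel₀ _ hT₁.ne'
      have g2 : T₁ * (l / T₁) = l := mul_div_cancel₀ _ hT₁.ne'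
      linarith
    have f2 : T₂ * (2 * A * (t2 - s2) - 2 * A * (t1 / T₁ - t2 / T₂) / T₂ + H₂ (p + v))
      = T₂ * (2 * A * (t2 - s2)) - 2 * A * (t1 / T₁ - t2 / T₂) + T₂ * H₂ (p + v) := by
      have g1 : T₂ * (2 * A * (t1 / T₁ - t2 / T₂) / T₂) = 2 * A * (t1 / T₁ - t2 / T₂) :=
        mul_div_cancel₀ _ hT₂.ne'
      linarith
    rw [f1] at m1
    rw [f2] at m2
    linarith
  · -- boundary case
    rw [abs_le] at hd1 hd2 hα
    have hmin : t1 ≤ κ ∨ t2 ≤ κ := by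
      by_contra hc
      push Not at hc
      exact hint ⟨by linarith, by linarith, by linarith, by linarith⟩
    have hκB : κ ≤ B * κ := le_mul_of_one_le_left hκ.le hB1
    have hq1 : 0 ≤ T₂ * (1 / T₁ + 1) * κ := by positivity
    have hq2 : 0 ≤ T₁ * (1 / T₂ + 1) * κ := by positivity
    have hBκ : B * κ = κ + T₂ * (1 / T₁ + 1) * κ + T₁ * (1 / T₂ + 1) * κ := by rw [hB]; ring
    have htt : t1 ≤ B * κ ∧ t2 ≤ B * κ := by
      rcases hmin with h | h
      · refine ⟨by linarith, ?_⟩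
        have e1 : t1 / T₁ ≤ κ / T₁ := by gcongr
        have e2 : t2 / T₂ ≤ (1 / T₁ + 1) * κ := by
          have : (1 / T₁ + 1) * κ = κ / T₁ + κ := by ring
          linarith
        rw [div_le_iff₀ hT₂] at e2
        linarith
      · refine ⟨?_, by linarith⟩
        have e1 : t2 / T₂ ≤ κ / T₂ := by gcongr
        have e2 : t1 / T₁ ≤ (1 / T₂ + 1) * κ := by
          have : (1 / T₂ + 1) * κ = κ / T₂ + κ := by ring
          linarith
        rw [div_le_iff₀ hT₁] at e2
        linarith
    obtain ⟨hb1, hb2⟩ := htt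
    have hE : 0 ≤ (B + 1) * κ := by positivity
    have w1 : w (t1, t2, x) - g x ≤ L * ((B + 1) * κ) := by
      have h := hwlip.dist_le_mul (t1, t2, x) ⟨ht1, ht2⟩ (0, 0, x) ⟨le_rfl, le_rfl⟩
      rw [hw.2.1, Real.dist_eq] at h
      refine (le_abs_self _).trans (h.trans ?_)
      gcongr
      simp only [Prod.dist_eq, Real.dist_eq, dist_self, sub_zero, abs_of_nonneg ht1, abs_of_nonneg ht2]
      refine max_le (by linarith) (max_le (by linarith) hE)
    have w2 : g y - w' (s1, s2, y) ≤ L' * ((B + 1) * κ) := by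
      have h := hw'lip.dist_le_mul (0, 0, y) ⟨le_rfl, le_rfl⟩ (s1, s2, y) ⟨hs1, hs2⟩
      rw [hw'.2.1, Real.dist_eq] at h
      refine (le_abs_self _).trans (h.trans ?_)
      gcongr
      simp only [Prod.dist_eq, Real.dist_eq, dist_self, zero_sub, abs_neg, abs_of_nonneg hs1, abs_of_nonneg hs2]
      refine max_le (by linarith) (max_le (by linarith) hE)
    have w3 : g x - g y ≤ K * ((B + 1) * κ) := by
      have h := hg.dist_le_mul x y
      rw [Real.dist_eq] at h
      refine (le_abs_self _).trans (h.trans ?_)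
      gcongr
      rw [dist_eq_norm]
      linarith
    linarith

lemma extend_bdry {d : ℕ} (w w' : ℝ × ℝ × EuclideanSpace ℝ (Fin d) → ℝ)
    (L L' : NNReal)
    (hwlip : LipschitzOnWith L w {p : ℝ × ℝ × EuclideanSpace ℝ (Fin d) | 0 ≤ p.1 ∧ 0 ≤ p.2.1})
    (hw'lip : LipschitzOnWith L' w' {p : ℝ × ℝ × EuclideanSpace ℝ (Fin d) | 0 ≤ p.1 ∧ 0 ≤ p.2.1})
    (h : ∀ T₁ T₂ x, 0 < T₁ → 0 < T₂ → w (T₁, T₂, x) ≤ w' (T₁, T₂, x))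
    (p : ℝ × ℝ × EuclideanSpace ℝ (Fin d)) (h1 : 0 ≤ p.1) (h2 : 0 ≤ p.2.1) : w p ≤ w' p := by
  obtain ⟨t1, t2, x⟩ := p
  simp only at h1 h2
  apply le_of_forall_pos_le_add
  intro ε hε
  set e := ε / ((L : ℝ) + L' + 1) with he
  have he0 : 0 < e := by positivity
  have hee : ((L : ℝ) + L' + 1) * e = ε := by rw [he]; field_simp
  have a1 := hwlip.dist_le_mul (t1, t2, x) ⟨h1, h2⟩ (t1 + e, t2 + e, x) ⟨by positivity, by positivity⟩
  have a2 := hw'lip.dist_le_mul (t1, t2, x) ⟨h1, h2⟩ (t1 + e, t2 + e, x) ⟨by positivity, by positivity⟩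
  have hd : dist ((t1, t2, x) : ℝ × ℝ × EuclideanSpace ℝ (Fin d)) (t1 + e, t2 + e, x) = e := by
    simp [Prod.dist_eq, abs_of_pos he0, he0.le]
  rw [hd, Real.dist_eq, abs_le] at a1 a2
  have := h (t1 + e) (t2 + e) x (by positivity) (by positivity)
  linarith [a1.2, a2.1]

/-- Uniqueness: if `g` is bounded and Lipschitz and `H₁, H₂` are convex and coercive,
then two Lipschitz, bounded viscosity solutions of the multi-time Hamilton–Jacobi system
with the same initial datum `g` coincide everywhere on `[0,∞)² × ℝ^d`. -/
theorem uniqueness_of_viscosity_solutions (d : ℕ) (H₁ H₂ g : EuclideanSpace ℝ (Fin d) → ℝ)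
    (hH₁ : ConvexOn ℝ Set.univ H₁) (hH₂ : ConvexOn ℝ Set.univ H₂)
    (hH₁coer : Coercive H₁) (hH₂coer : Coercive H₂)
    (K : NNReal) (hg : LipschitzWith K g) (Cg : ℝ) (hgbdd : ∀ x, |g x| ≤ Cg)
    (w w' : ℝ × ℝ × EuclideanSpace ℝ (Fin d) → ℝ)
    (L L' : NNReal)
    (hwlip : LipschitzOnWith L w {p : ℝ × ℝ × EuclideanSpace ℝ (Fin d) | 0 ≤ p.1 ∧ 0 ≤ p.2.1})
    (hw'lip : LipschitzOnWith L' w' {p : ℝ × ℝ × EuclideanSpace ℝ (Fin d) | 0 ≤ p.1 ∧ 0 ≤ p.2.1})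
    (Cw : ℝ) (hwbdd : ∀ p, |w p| ≤ Cw) (Cw' : ℝ) (hw'bdd : ∀ p, |w' p| ≤ Cw')
    (hw : IsViscositySubsolution H₁ H₂ g w ∧ IsViscositySupersolution H₁ H₂ g w)
    (hw' : IsViscositySubsolution H₁ H₂ g w' ∧ IsViscositySupersolution H₁ H₂ g w') :
    ∀ p : ℝ × ℝ × EuclideanSpace ℝ (Fin d), 0 ≤ p.1 → 0 ≤ p.2.1 → w p = w' p := by
  intro p h1 h2
  have c₁ : Continuous H₁ := by
    rw [← continuousOn_univ]; exact hH₁.continuousOn isOpen_univ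
  have c₂ : Continuous H₂ := by
    rw [← continuousOn_univ]; exact hH₂.continuousOn isOpen_univ
  apply le_antisymm
  · exact extend_bdry w w' L L' hwlip hw'lip (fun T₁ T₂ x a b =>
      comparison H₁ H₂ g c₁ c₂ K hg w w' L L' hwlip hw'lip (Cw + Cw')
        (fun p q => by linarith [(abs_le.1 (hwbdd p)).2, (abs_le.1 (hw'bdd q)).1])
        hw.1 hw'.2 T₁ T₂ x a b) p h1 h2
  · exact extend_bdry w' w L' L hw'lip hwlip (fun T₁ T₂ x a b =>
      comparison H₁ H₂ g c₁ c₂ K hg w' w L' L hw'lip hwlip (Cw + Cw')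
        (fun p q => by linarith [(abs_le.1 (hwbdd q)).1, (abs_le.1 (hw'bdd p)).2])
        hw'.1 hw.2 T₁ T₂ x a b) p h1 h2
end

section
/- Let φ : ℝ → ℝ be strictly convex and coercive, let g : ℝ → ℝ be Lipschitz continuous, and let x₁ < x₂. Suppose y₁ ∈ ℝ attains the minimum of y ↦ φ(x₁ − y) + g(y). Then for every y < y₁, φ(x₂ − y₁) + g(y₁) < φ(x₂ − y) + g(y). Consequently, every minimizer of y ↦ φ(x₂ − y) + g(y) is ≥ y₁. -/
open Filter

/-- `φ : ℝ → ℝ` is coercive: `φ x / |x| → +∞` as `|x| → ∞`. -/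
def CoerciveR (φ : ℝ → ℝ) : Prop :=
  Tendsto (fun x => φ x / |x|) (Filter.comap (fun x : ℝ => |x|) atTop) atTop

/-- Let `φ` be strictly convex and coercive, `g` Lipschitz and `x₁ < x₂`. If `y₁`
minimizes `y ↦ φ(x₁ - y) + g y`, then for every `y < y₁` one has
`φ(x₂ - y₁) + g y₁ < φ(x₂ - y) + g y`; consequently every minimizer of
`y ↦ φ(x₂ - y) + g y` is `≥ y₁`. -/
theorem minimizers_move_right (φ g : ℝ → ℝ) (hφ : StrictConvexOn ℝ Set.univ φ)
    (hφcoer : CoerciveR φ) (K : NNReal) (hg : LipschitzWith K g)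
    (x₁ x₂ : ℝ) (hx : x₁ < x₂) (y₁ : ℝ)
    (hy₁ : ∀ y : ℝ, φ (x₁ - y₁) + g y₁ ≤ φ (x₁ - y) + g y) :
    (∀ y : ℝ, y < y₁ → φ (x₂ - y₁) + g y₁ < φ (x₂ - y) + g y) ∧
    (∀ y' : ℝ, (∀ y : ℝ, φ (x₂ - y') + g y' ≤ φ (x₂ - y) + g y) → y₁ ≤ y') := by
  have key : ∀ y : ℝ, y < y₁ → φ (x₂ - y₁) + g y₁ < φ (x₂ - y) + g y := by
    intro y hy
    have hd : 0 < (x₂ - x₁) + (y₁ - y) := by linarith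
    have hne : x₁ - y₁ ≠ x₂ - y := by intro h; linarith
    have hs : 0 < (x₂ - x₁) / ((x₂ - x₁) + (y₁ - y)) := div_pos (by linarith) hd
    have ht : 0 < (y₁ - y) / ((x₂ - x₁) + (y₁ - y)) := div_pos (by linarith) hd
    have hst : (x₂ - x₁) / ((x₂ - x₁) + (y₁ - y)) + (y₁ - y) / ((x₂ - x₁) + (y₁ - y)) = 1 := by
      rw [← add_div, div_self hd.ne']
    have hsd : (x₂ - x₁) / ((x₂ - x₁) + (y₁ - y)) * ((x₂ - x₁) + (y₁ - y)) = x₂ - x₁ :=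
      div_mul_cancel₀ _ hd.ne'
    generalize (x₂ - x₁) / ((x₂ - x₁) + (y₁ - y)) = s at *
    generalize (y₁ - y) / ((x₂ - x₁) + (y₁ - y)) = t at *
    obtain rfl : t = 1 - s := by linarith
    have h1 := hφ.2 (Set.mem_univ (x₁ - y₁)) (Set.mem_univ (x₂ - y)) hne hs ht (by ring)
    have h2 := hφ.2 (Set.mem_univ (x₁ - y₁)) (Set.mem_univ (x₂ - y)) hne ht hs (by ring)
    simp only [smul_eq_mul] at h1 h2
    rw [show s * (x₁ - y₁) + (1 - s) * (x₂ - y) = x₁ - y by linear_combination -hsd] at h1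
    rw [show (1 - s) * (x₁ - y₁) + s * (x₂ - y) = x₂ - y₁ by linear_combination hsd] at h2
    have h3 := hy₁ y
    linarith
  refine ⟨key, fun y' h => ?_⟩
  by_contra hlt
  exact absurd (key y' (not_le.mp hlt)) (not_lt.mpr (h y₁))
end

section
/- (Multi-time Lax–Oleinik one-sided Lipschitz estimate.) Let φ : ℝ → ℝ be strictly convex, coercive and differentiable with φ' Lipschitz continuous with constant L, let g : ℝ → ℝ be Lipschitz continuous, and for x ∈ ℝ let y(x) denote the smallest minimizer of y ↦ φ(x − y) + g(y). Define u(x) = φ'(x − y(x)). Then for every x ∈ ℝ and every z > 0, u(x + z) − u(x) ≤ L·z. -/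
open Filter

/-- Multi-time Lax–Oleinik one-sided Lipschitz estimate: if `φ` is strictly convex,
coercive and differentiable with `φ'` Lipschitz with constant `L`, `g` is Lipschitz,
`Y x` is the smallest minimizer of `y ↦ φ(x - y) + g y`, and `u x = φ'(x - Y x)`, then
`u (x + z) - u x ≤ L z` for all `x` and all `z > 0`. -/
theorem lax_oleinik_one_sided_lipschitz (φ g : ℝ → ℝ)
    (hφ : StrictConvexOn ℝ Set.univ φ) (hφcoer : CoerciveR φ)
    (hφdiff : Differentiable ℝ φ) (L : NNReal) (hL : LipschitzWith L (deriv φ))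
    (K : NNReal) (hg : LipschitzWith K g)
    (Y : ℝ → ℝ)
    (hY : ∀ x : ℝ, IsLeast {y' | ∀ z : ℝ, φ (x - y') + g y' ≤ φ (x - z) + g z} (Y x)) :
    ∀ x z : ℝ, 0 < z →
      deriv φ (x + z - Y (x + z)) - deriv φ (x - Y x) ≤ (L : ℝ) * z := by
  intro x z hz
  have hmono : Y x ≤ Y (x + z) := by
    by_contra hlt
    push Not at hlt
    have h1 := (hY x).1 (Y (x + z))
    have h2 := (hY (x + z)).1 (Y x)
    generalize Y x = a at *
    generalize Y (x + z) = b at *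
    have hd : 0 < a - b := by linarith
    have hs : 0 < a - b + z := by linarith
    have hne : x - a ≠ x + z - b := by intro h; linarith
    have hsum : z / (a - b + z) + (a - b) / (a - b + z) = 1 := by
      field_simp; ring
    have k1 := hφ.2 (Set.mem_univ (x - a)) (Set.mem_univ (x + z - b)) hne
      (div_pos hz hs) (div_pos hd hs) hsum
    have k2 := hφ.2 (Set.mem_univ (x - a)) (Set.mem_univ (x + z - b)) hne
      (div_pos hd hs) (div_pos hz hs) (by rw [add_comm]; exact hsum)
    simp only [smul_eq_mul] at k1 k2
    have e1 : z / (a - b + z) * (x - a) + (a - b) / (a - b + z) * (x + z - b) = x - b := by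
      field_simp; ring
    have e2 : (a - b) / (a - b + z) * (x - a) + z / (a - b + z) * (x + z - b) = x + z - a := by
      field_simp; ring
    rw [e1] at k1
    rw [e2] at k2
    have e3 : z / (a - b + z) * φ (x - a) + (a - b) / (a - b + z) * φ (x - a) = φ (x - a) := by
      rw [← add_mul, hsum, one_mul]
    have e4 : z / (a - b + z) * φ (x + z - b) + (a - b) / (a - b + z) * φ (x + z - b)
        = φ (x + z - b) := by
      rw [← add_mul, hsum, one_mul]
    linarith
  have hder : Monotone (deriv φ) := by
    have := hφ.convexOn.monotoneOn_deriv (fun x _ => hφdiff x)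
    intro p q hpq
    exact this (Set.mem_univ p) (Set.mem_univ q) hpq
  have h1 : deriv φ (x + z - Y (x + z)) ≤ deriv φ (x + z - Y x) := hder (by linarith)
  have h2 := hL.dist_le_mul (x + z - Y x) (x - Y x)
  rw [Real.dist_eq, Real.dist_eq, show x + z - Y x - (x - Y x) = z by ring, abs_of_pos hz] at h2
  have h3 := le_abs_self (deriv φ (x + z - Y x) - deriv φ (x - Y x))
  linarith
end

section
/- Let H₁, H₂ : ℝ → ℝ be smooth uniformly convex, u₀ ∈ L^∞(ℝ), g(x) = ∫₀ˣ u₀(y) dy, and let w(t₁,t₂,x) = min_{y∈ℝ} { (t₁H₁ + t₂H₂)*(x−y) + g(y) }. Then the function u ∈ L^∞((0,∞)² × ℝ) defined (a.e.) by u = ∂_x w is a weak integral solution of the multi-time system of conservation laws: for all test functions φ ∈ C_c^∞((0,∞)² × ℝ), ∫∫∫ ( u φ_{t₁} + H₁(u) φ_x ) dx dt₁ dt₂ = 0 and ∫∫∫ ( u φ_{t₂} + H₂(u) φ_x ) dx dt₁ dt₂ = 0, and for every γ ∈ L¹(ℝ), ess-lim_{t₁,t₂→0⁺} ∫_ℝ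 ( u(t₁,t₂,x) − u₀(x) ) γ(x) dx = 0. -/
open Filter Topology MeasureTheory intervalIntegral

/-- The (real-valued, one-dimensional) Legendre–Fenchel conjugate
`f*(p) = sup_y (p y - f y)`. -/
noncomputable def conj1 (f : ℝ → ℝ) (p : ℝ) : ℝ := ⨆ y, (p * y - f y)

/-- The multi-time Lax formula in one space dimension,
`w(t₁,t₂,x) = inf_y { (t₁H₁ + t₂H₂)*(x - y) + g y }` with `g y = ∫₀ʸ u₀`. -/
noncomputable def lax1 (H₁ H₂ u₀ : ℝ → ℝ) (t₁ t₂ x : ℝ) : ℝ :=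
  ⨅ y : ℝ, (conj1 (fun ξ => t₁ * H₁ ξ + t₂ * H₂ ξ) (x - y) + ∫ s in (0:ℝ)..y, u₀ s)

def Nice (H : ℝ → ℝ) : Prop :=
  Differentiable ℝ H ∧ ∃ c > 0, ∀ x y, H x + deriv H x * (y - x) + c * (y - x) ^ 2 ≤ H y

lemma nice_of {H : ℝ → ℝ} (hs : ContDiff ℝ (⊤ : ℕ∞) H) {c : ℝ} (hc : 0 < c)
    (hu : ∀ x : ℝ, c ≤ iteratedDeriv 2 H x) : Nice H := by
  have hd : Differentiable ℝ H := hs.differentiable (by simp)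
  have hd2 : Differentiable ℝ (deriv H) := by
    have : ContDiff ℝ 1 (deriv H) := by
      have h2 : ContDiff ℝ (1 + 1) H := hs.of_le (by norm_cast)
      exact (contDiff_succ_iff_deriv.1 h2).2.2
    exact this.differentiable (by simp)
  refine ⟨hd, c / 2, by positivity, ?_⟩
  have hmono : Monotone (fun y => deriv H y - c * y) := by
    apply monotone_of_deriv_nonneg
    · fun_prop
    · intro x
      have h1 : HasDerivAt (fun y => deriv H y - c * y) (deriv (deriv H) x - c * 1) x :=
        (hd2 x).hasDerivAt.sub ((hasDerivAt_id x).const_mul c)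
      rw [h1.deriv]
      have := hu x
      rw [iteratedDeriv_succ, iteratedDeriv_one] at this
      linarith
  have hF : ∀ y, HasDerivAt (fun y => H y - c / 2 * y ^ 2) (deriv H y - c * y) y := by
    intro y
    have := (hd y).hasDerivAt.sub (((hasDerivAt_id y).pow 2).const_mul (c / 2))
    refine this.congr_deriv ?_
    simp; ring
  have hcv : ConvexOn ℝ Set.univ (fun y => H y - c / 2 * y ^ 2) := by
    apply Monotone.convexOn_univ_of_deriv
    · intro y; exact (hF y).differentiableAt
    · have : deriv (fun y => H y - c / 2 * y ^ 2) = fun y => deriv H y - c * y :=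
        funext fun y => (hF y).deriv
      rw [this]; exact hmono
  intro x y
  rcases lt_trichotomy x y with h | h | h
  · have := hcv.deriv_le_slope (Set.mem_univ x) (Set.mem_univ y) h (hF x).differentiableAt
    rw [(hF x).deriv, slope_def_field, le_div_iff₀ (by linarith)] at this
    nlinarith
  · subst h; simp
  · have := hcv.slope_le_deriv (Set.mem_univ y) (Set.mem_univ x) h (hF x).differentiableAt
    rw [(hF x).deriv, slope_def_field, div_le_iff₀ (by linarith)] at this
    nlinarith

lemma Nice.smul {H : ℝ → ℝ} (hH : Nice H) {t : ℝ} (ht : 0 < t) : Nice (fun ξ => t * H ξ) := by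
  obtain ⟨hd, c, hc, h⟩ := hH
  refine ⟨hd.const_mul t, t * c, by positivity, fun x y => ?_⟩
  rw [deriv_const_mul _ (hd x)]
  have := mul_le_mul_of_nonneg_left (h x y) ht.le
  nlinarith

lemma Nice.add {H G : ℝ → ℝ} (hH : Nice H) (hG : Nice G) : Nice (fun ξ => H ξ + G ξ) := by
  obtain ⟨hd, c, hc, h⟩ := hH
  obtain ⟨hd', c', hc', h'⟩ := hG
  refine ⟨hd.add hd', c + c', by positivity, fun x y => ?_⟩
  have : deriv (fun ξ => H ξ + G ξ) x = deriv H x + deriv G x := deriv_fun_add (hd x) (hd' x)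
  rw [this]
  have := h x y
  have := h' x y
  nlinarith

lemma Nice.le_tangent {H : ℝ → ℝ} (hH : Nice H) (x y : ℝ) : H x + deriv H x * (y - x) ≤ H y := by
  obtain ⟨hd, c, hc, h⟩ := hH
  have := h x y
  nlinarith [mul_nonneg hc.le (sq_nonneg (y - x))]

lemma Nice.exists_deriv_eq {H : ℝ → ℝ} (hH : Nice H) (p : ℝ) : ∃ y, deriv H y = p := by
  have hH' := hH
  obtain ⟨hd, c, hc, h⟩ := hH
  have hcont : Continuous (fun y => H y - p * y) := by
    have := hd.continuous
    fun_prop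
  have hb : ∀ y, H 0 - p * 0 + ((deriv H 0 - p) * y + c * y ^ 2) ≤ H y - p * y := by
    intro y
    have := h 0 y
    simp at this
    nlinarith
  obtain ⟨y, hy⟩ : ∃ x, ∀ y, (fun y => H y - p * y) x ≤ (fun y => H y - p * y) y := by
    apply hcont.exists_forall_le_of_isBounded 0
    rw [Metric.isBounded_iff_subset_closedBall 0]
    refine ⟨|deriv H 0 - p| / c, fun y hy => ?_⟩
    simp only [Set.mem_ofPred_eq] at hy
    simp only [Metric.mem_closedBall, dist_zero_right, Real.norm_eq_abs]
    rw [le_div_iff₀ hc]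
    have h1 := hb y
    have h2 : c * y ^ 2 ≤ |deriv H 0 - p| * |y| := by
      rw [← abs_mul]
      have := neg_abs_le ((deriv H 0 - p) * y)
      linarith
    by_contra hcon
    push Not at hcon
    have hy0 : 0 < |y| := by
      rcases (abs_nonneg y).eq_or_lt with h0 | h0
      · rw [← h0] at hcon; simp at hcon
        exact absurd hcon (not_lt.2 (abs_nonneg _))
      · exact h0
    have := mul_lt_mul_of_pos_right hcon hy0
    rw [← sq_abs] at h2
    nlinarith
  refine ⟨y, ?_⟩
  have hm : IsLocalMin (fun y => H y - p * y) y := Filter.Eventually.of_forall hy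
  have h1 : HasDerivAt (fun y => H y - p * y) (deriv H y - p * 1) y :=
    (hd y).hasDerivAt.sub ((hasDerivAt_id y).const_mul p)
  have := hm.hasDerivAt_eq_zero h1
  linarith

lemma Nice.isGreatest {H : ℝ → ℝ} (hH : Nice H) (y : ℝ) :
    IsGreatest (Set.range fun z => deriv H y * z - H z) (deriv H y * y - H y) := by
  refine ⟨⟨y, rfl⟩, ?_⟩
  rintro _ ⟨z, rfl⟩
  have := hH.le_tangent y z
  simp only
  linarith

lemma Nice.conj_deriv {H : ℝ → ℝ} (hH : Nice H) (y : ℝ) :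
    conj1 H (deriv H y) = deriv H y * y - H y :=
  (hH.isGreatest y).csSup_eq

lemma Nice.le_conj {H : ℝ → ℝ} (hH : Nice H) (p y : ℝ) : p * y - H y ≤ conj1 H p := by
  obtain ⟨z, rfl⟩ := hH.exists_deriv_eq p
  rw [hH.conj_deriv]
  exact (hH.isGreatest z).2 ⟨y, rfl⟩

lemma Nice.conj_ge_abs {H : ℝ → ℝ} (hH : Nice H) (M p : ℝ) :
    M * |p| - max (H M) (H (-M)) ≤ conj1 H p := by
  rcases abs_cases p with ⟨h, _⟩ | ⟨h, _⟩
  · have := hH.le_conj p M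
    have := le_max_left (H M) (H (-M))
    rw [h]; linarith
  · have := hH.le_conj p (-M)
    have := le_max_right (H M) (H (-M))
    rw [h]; linarith

lemma conj_smul_zero {H : ℝ → ℝ} (hH : Nice H) {t : ℝ} (ht : 0 < t) :
    conj1 (fun ξ => t * H ξ) 0 = t * conj1 H 0 := by
  obtain ⟨y, hy⟩ := hH.exists_deriv_eq 0
  have h1 := hH.conj_deriv y
  have h2 := (hH.smul ht).conj_deriv y
  rw [deriv_const_mul _ (hH.1 y)] at h2
  rw [hy] at h1 h2
  simp at h1 h2
  rw [h1, h2]; ring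

lemma conj_add_le {H G : ℝ → ℝ} (hH : Nice H) (hG : Nice G) (p q : ℝ) :
    conj1 (fun ξ => H ξ + G ξ) (p + q) ≤ conj1 H p + conj1 G q := by
  apply ciSup_le
  intro y
  have := hH.le_conj p y
  have := hG.le_conj q y
  linarith

lemma conj_add_split {H G : ℝ → ℝ} (hH : Nice H) (hG : Nice G) (p : ℝ) :
    ∃ q, conj1 H q + conj1 G (p - q) = conj1 (fun ξ => H ξ + G ξ) p := by
  obtain ⟨y, hy⟩ := (hH.add hG).exists_deriv_eq p
  have h1 := (hH.add hG).conj_deriv y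
  have : deriv (fun ξ => H ξ + G ξ) y = deriv H y + deriv G y := deriv_fun_add (hH.1 y) (hG.1 y)
  rw [hy] at h1
  rw [hy] at this
  refine ⟨deriv H y, ?_⟩
  rw [show p - deriv H y = deriv G y by linarith, hH.conj_deriv, hG.conj_deriv, h1, this]
  ring

/-- inf-convolution -/
noncomputable def Qop (H f : ℝ → ℝ) (x : ℝ) : ℝ := ⨅ y : ℝ, (conj1 H (x - y) + f y)

def Lip (C : ℝ) (f : ℝ → ℝ) : Prop := ∀ x y, |f x - f y| ≤ C * |x - y|

lemma Lip.le {C : ℝ} {f : ℝ → ℝ} (hf : Lip C f) (x y : ℝ) : f x - C * |x - y| ≤ f y := by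
  have := (abs_le.1 (hf x y)).2
  linarith

lemma qop_term_ge {H f : ℝ → ℝ} (hH : Nice H) {C : ℝ} (hf : Lip C f) (x y : ℝ) :
    f x - max (H C) (H (-C)) ≤ conj1 H (x - y) + f y := by
  have := hH.conj_ge_abs C (x - y)
  have := hf.le x y
  linarith

lemma qop_bdd {H f : ℝ → ℝ} (hH : Nice H) {C : ℝ} (hf : Lip C f) (x : ℝ) :
    BddBelow (Set.range fun y => conj1 H (x - y) + f y) := by
  refine ⟨f x - max (H C) (H (-C)), ?_⟩
  rintro _ ⟨y, rfl⟩
  exact qop_term_ge hH hf x y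

lemma qop_le {H f : ℝ → ℝ} (hH : Nice H) {C : ℝ} (hf : Lip C f) (x y : ℝ) :
    Qop H f x ≤ conj1 H (x - y) + f y := ciInf_le (qop_bdd hH hf x) y

lemma qop_lip {H f : ℝ → ℝ} (hH : Nice H) {C : ℝ} (hf : Lip C f) : Lip C (Qop H f) := by
  have key : ∀ x z, Qop H f x - C * |x - z| ≤ Qop H f z := by
    intro x z
    apply le_ciInf
    intro y
    have h1 := qop_le hH hf x (x - (z - y))
    have h2 := hf.le (x - (z - y)) y
    rw [show x - (x - (z - y)) = z - y by ring] at h1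
    rw [show x - (z - y) - y = x - z by ring] at h2
    linarith
  intro x y
  rw [abs_le]
  have h1 := key x y
  have h2 := key y x
  rw [abs_sub_comm y x] at h2
  constructor <;> linarith

lemma qop_semigroup {H G f : ℝ → ℝ} (hH : Nice H) (hG : Nice G) {C : ℝ} (hf : Lip C f) (x : ℝ) :
    Qop (fun ξ => H ξ + G ξ) f x = Qop H (Qop G f) x := by
  apply le_antisymm
  · apply le_ciInf
    intro z
    have : Qop (fun ξ => H ξ + G ξ) f x - conj1 H (x - z) ≤ Qop G f z := by
      apply le_ciInf
      intro y
      have h1 := qop_le (hH.add hG) hf x y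
      have h2 := conj_add_le hH hG (x - z) (z - y)
      rw [show x - z + (z - y) = x - y by ring] at h2
      linarith
    linarith
  · apply le_ciInf
    intro y
    obtain ⟨q, hq⟩ := conj_add_split hH hG (x - y)
    rw [← hq]
    have h1 := qop_le hH (qop_lip hG hf) x (x - q)
    have h2 := qop_le hG hf (x - q) y
    rw [show x - (x - q) = q by ring] at h1
    rw [show x - q - y = x - y - q by ring] at h2
    linarith

noncomputable def Kc (H : ℝ → ℝ) (C : ℝ) : ℝ := max |max (H C) (H (-C))| |conj1 H 0|

lemma Kc_nonneg (H : ℝ → ℝ) (C : ℝ) : 0 ≤ Kc H C := (abs_nonneg _).trans (le_max_left _ _)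

lemma qop_sub_le {H f : ℝ → ℝ} (hH : Nice H) {C : ℝ} (hf : Lip C f) {t : ℝ} (ht : 0 < t) (x : ℝ) :
    |Qop (fun ξ => t * H ξ) f x - f x| ≤ Kc H C * t := by
  have h1 := qop_le (hH.smul ht) hf x x
  rw [sub_self, conj_smul_zero hH ht] at h1
  have h2 : f x - max (t * H C) (t * H (-C)) ≤ Qop (fun ξ => t * H ξ) f x :=
    le_ciInf fun y => qop_term_ge (hH.smul ht) hf x y
  rw [← mul_max_of_nonneg _ _ ht.le] at h2
  have h3 : conj1 H 0 ≤ Kc H C := (le_abs_self _).trans (le_max_right _ _)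
  have h4 : max (H C) (H (-C)) ≤ Kc H C := (le_abs_self _).trans (le_max_left _ _)
  rw [abs_le]
  constructor <;> nlinarith

lemma qop_hj {H f : ℝ → ℝ} (hH : Nice H) {C : ℝ} (hf : Lip C f) {a x : ℝ}
    (ha : HasDerivAt f a x) :
    Tendsto (fun h : ℝ => h⁻¹ * (Qop (fun ξ => h * H ξ) f x - f x)) (𝓝[>] 0) (𝓝 (-H a)) := by
  -- R
  obtain ⟨R, hR0, hR1, hR2⟩ : ∃ R : ℝ, 0 < R ∧ max (H (C + 1)) (H (-(C + 1))) - H a ≤ R ∧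
      |deriv H a| ≤ R :=
    ⟨max 1 (max (max (H (C + 1)) (H (-(C + 1))) - H a) |deriv H a|),
      lt_of_lt_of_le one_pos (le_max_left _ _),
      (le_max_left _ _).trans (le_max_right _ _), (le_max_right _ _).trans (le_max_right _ _)⟩
  rw [Metric.tendsto_nhds]
  intro ε hε
  have hε' : 0 < ε / (2 * R) := by positivity
  have hlo := (hasDerivAt_iff_isLittleO.1 ha).def hε'
  rw [Metric.eventually_nhds_iff] at hlo
  obtain ⟨δ, hδ, hlo⟩ := hlo
  have hev : ∀ᶠ h : ℝ in 𝓝[>] 0, h ∈ Set.Ioo 0 (δ / R) :=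
    Ioo_mem_nhdsGT (by positivity)
  filter_upwards [hev] with h hh
  obtain ⟨h0, h1⟩ := hh
  rw [lt_div_iff₀ hR0] at h1
  have happ : ∀ y, |x - y| ≤ h * R → |f y - f x - (y - x) * a| ≤ ε / 2 * h := by
    intro y hy
    have h2 : dist y x < δ := by rw [Real.dist_eq, abs_sub_comm]; linarith
    have := hlo h2
    simp only [Real.norm_eq_abs, smul_eq_mul] at this
    refine this.trans ?_
    rw [abs_sub_comm y x]
    calc ε / (2 * R) * |x - y| ≤ ε / (2 * R) * (h * R) := by gcongr
      _ = ε / 2 * h := by field_simp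
  have hn := hH.smul h0
  have up : Qop (fun ξ => h * H ξ) f x ≤ f x - h * H a + ε / 2 * h := by
    have h2 := qop_le hn hf x (x - h * deriv H a)
    have h3 := hn.conj_deriv a
    rw [deriv_const_mul _ (hH.1 a)] at h3
    rw [show x - (x - h * deriv H a) = h * deriv H a by ring, h3] at h2
    have h4 := happ (x - h * deriv H a) (by
      rw [show x - (x - h * deriv H a) = h * deriv H a by ring, abs_mul, abs_of_pos h0]
      gcongr)
    have := (abs_le.1 h4).2
    linarith
  have lo : f x - h * H a - ε / 2 * h ≤ Qop (fun ξ => h * H ξ) f x := by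
    apply le_ciInf
    intro y
    by_cases hy : |x - y| ≤ h * R
    · have h4 := (abs_le.1 (happ y hy)).1
      have h5 := hn.le_conj (x - y) a
      linarith
    · push Not at hy
      have h5 := hn.conj_ge_abs (C + 1) (x - y)
      rw [← mul_max_of_nonneg _ _ h0.le] at h5
      have h6 := hf.le x y
      have h7 := mul_le_mul_of_nonneg_left hR1 h0.le
      have : 0 < ε / 2 * h := by positivity
      linarith
  rw [Real.dist_eq, show h⁻¹ * (Qop (fun ξ => h * H ξ) f x - f x) - -H a
    = (Qop (fun ξ => h * H ξ) f x - f x + h * H a) / h by field_simp; ring, abs_div, abs_of_pos h0,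
    div_lt_iff₀ h0]
  have : 0 < ε * h := by positivity
  have h8 : |Qop (fun ξ => h * H ξ) f x - f x + h * H a| ≤ ε / 2 * h := by
    rw [abs_le]; constructor <;> linarith
  linarith

section laxfacts
variable {H₁ H₂ u₀ : ℝ → ℝ} {C : ℝ}

lemma lax_eq (t₁ t₂ : ℝ) : lax1 H₁ H₂ u₀ t₁ t₂ =
    Qop (fun ξ => t₁ * H₁ ξ + t₂ * H₂ ξ) (fun y => ∫ s in (0:ℝ)..y, u₀ s) := rfl

lemma bdd_locInt (hm : Measurable u₀) (hb : ∀ x, |u₀ x| ≤ C) : LocallyIntegrable u₀ volume :=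
  (memLp_top_of_bound hm.aestronglyMeasurable C (.of_forall hb)).locallyIntegrable le_top

lemma g_lip (hm : Measurable u₀) (hb : ∀ x, |u₀ x| ≤ C) :
    Lip C (fun y => ∫ s in (0:ℝ)..y, u₀ s) := by
  have hi : ∀ a b, IntervalIntegrable u₀ volume a b := fun a b =>
    ((bdd_locInt hm hb).integrableOn_isCompact isCompact_uIcc).intervalIntegrable
  intro x y
  simp only
  rw [intervalIntegral.integral_interval_sub_left (hi _ _) (hi _ _), ← Real.norm_eq_abs]
  exact intervalIntegral.norm_integral_le_of_norm_le_const (fun z _ => (Real.norm_eq_abs _).trans_le (hb z))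

lemma lax_lip (h1 : Nice H₁) (h2 : Nice H₂) (hg : Lip C (fun y => ∫ s in (0:ℝ)..y, u₀ s))
    {t₁ t₂ : ℝ} (ht₁ : 0 < t₁) (ht₂ : 0 < t₂) : Lip C (lax1 H₁ H₂ u₀ t₁ t₂) :=
  qop_lip ((h1.smul ht₁).add (h2.smul ht₂)) hg

lemma lax_step1 (h1 : Nice H₁) (h2 : Nice H₂) (hg : Lip C (fun y => ∫ s in (0:ℝ)..y, u₀ s))
    {t₁ t₂ h : ℝ} (ht₁ : 0 < t₁) (ht₂ : 0 < t₂) (hh : 0 < h) (x : ℝ) :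
    lax1 H₁ H₂ u₀ (t₁ + h) t₂ x = Qop (fun ξ => h * H₁ ξ) (lax1 H₁ H₂ u₀ t₁ t₂) x := by
  rw [lax_eq t₁ t₂, ← qop_semigroup (h1.smul hh) ((h1.smul ht₁).add (h2.smul ht₂)) hg, lax_eq]
  congr 1
  funext ξ; ring

lemma lax_step2 (h1 : Nice H₁) (h2 : Nice H₂) (hg : Lip C (fun y => ∫ s in (0:ℝ)..y, u₀ s))
    {t₁ t₂ h : ℝ} (ht₁ : 0 < t₁) (ht₂ : 0 < t₂) (hh : 0 < h) (x : ℝ) :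
    lax1 H₁ H₂ u₀ t₁ (t₂ + h) x = Qop (fun ξ => h * H₂ ξ) (lax1 H₁ H₂ u₀ t₁ t₂) x := by
  rw [lax_eq t₁ t₂, ← qop_semigroup (h2.smul hh) ((h1.smul ht₁).add (h2.smul ht₂)) hg, lax_eq]
  congr 1
  funext ξ; ring

lemma lax_init (h1 : Nice H₁) (h2 : Nice H₂) (hg : Lip C (fun y => ∫ s in (0:ℝ)..y, u₀ s))
    {t₁ t₂ : ℝ} (ht₁ : 0 < t₁) (ht₂ : 0 < t₂) (x : ℝ) :
    |lax1 H₁ H₂ u₀ t₁ t₂ x - ∫ s in (0:ℝ)..x, u₀ s| ≤ Kc H₁ C * t₁ + Kc H₂ C * t₂ := by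
  rw [lax_eq, qop_semigroup (h1.smul ht₁) (h2.smul ht₂) hg]
  have a := qop_sub_le h1 (qop_lip (h2.smul ht₂) hg) ht₁ x
  have b := qop_sub_le h2 hg ht₂ x
  rw [abs_le] at *
  constructor <;> linarith [a.1, a.2, b.1, b.2]

lemma lax_t1 (h1 : Nice H₁) (h2 : Nice H₂) (hg : Lip C (fun y => ∫ s in (0:ℝ)..y, u₀ s))
    {s t t₂ : ℝ} (hs : 0 < s) (ht : 0 < t) (ht₂ : 0 < t₂) (x : ℝ) :
    |lax1 H₁ H₂ u₀ s t₂ x - lax1 H₁ H₂ u₀ t t₂ x| ≤ Kc H₁ C * |s - t| := by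
  wlog hst : t < s generalizing s t
  · rcases (not_lt.1 hst).eq_or_lt with h | h
    · subst h; simp
    · rw [abs_sub_comm, abs_sub_comm s]; exact this ht hs h
  have := qop_sub_le h1 (lax_lip h1 h2 hg ht ht₂) (sub_pos.2 hst) x
  rw [← lax_step1 h1 h2 hg ht ht₂ (sub_pos.2 hst)] at this
  rw [abs_of_pos (sub_pos.2 hst)]
  simpa using this

lemma lax_t2 (h1 : Nice H₁) (h2 : Nice H₂) (hg : Lip C (fun y => ∫ s in (0:ℝ)..y, u₀ s))
    {s t t₁ : ℝ} (hs : 0 < s) (ht : 0 < t) (ht₁ : 0 < t₁) (x : ℝ) :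
    |lax1 H₁ H₂ u₀ t₁ s x - lax1 H₁ H₂ u₀ t₁ t x| ≤ Kc H₂ C * |s - t| := by
  wlog hst : t < s generalizing s t
  · rcases (not_lt.1 hst).eq_or_lt with h | h
    · subst h; simp
    · rw [abs_sub_comm, abs_sub_comm s]; exact this ht hs h
  have := qop_sub_le h2 (lax_lip h1 h2 hg ht₁ ht) (sub_pos.2 hst) x
  rw [← lax_step2 h1 h2 hg ht₁ ht (sub_pos.2 hst)] at this
  rw [abs_of_pos (sub_pos.2 hst)]
  simpa using this

noncomputable def Wt (H₁ H₂ u₀ : ℝ → ℝ) (δ : ℝ) (p : ℝ × ℝ × ℝ) : ℝ :=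
  lax1 H₁ H₂ u₀ (max p.1 δ) (max p.2.1 δ) p.2.2

lemma Wt_lip (h1 : Nice H₁) (h2 : Nice H₂) (hC : 0 ≤ C)
    (hg : Lip C (fun y => ∫ s in (0:ℝ)..y, u₀ s))
    {δ : ℝ} (hδ : 0 < δ) :
    LipschitzWith (Kc H₁ C + Kc H₂ C + C).toNNReal (Wt H₁ H₂ u₀ δ) := by
  have hK1 := Kc_nonneg H₁ C
  have hK2 := Kc_nonneg H₂ C
  apply LipschitzWith.of_dist_le_mul
  rintro ⟨a, b, c⟩ ⟨a', b', c'⟩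
  rw [Real.coe_toNNReal _ (by positivity), Real.dist_eq]
  simp only [Wt]
  have pos : ∀ z : ℝ, 0 < max z δ := fun z => lt_max_of_lt_right hδ
  have e1 := lax_t1 h1 h2 hg (pos a) (pos a') (pos b) c
  have e2 := lax_t2 h1 h2 hg (pos b) (pos b') (pos a') c
  have e3 := lax_lip h1 h2 hg (pos a') (pos b') c c'
  have d1 : |max a δ - max a' δ| ≤ dist (a, b, c) (a', b', c') :=
    (abs_max_sub_max_le_abs _ _ _).trans (by rw [Prod.dist_eq]; exact le_max_left _ _)
  have d2 : |max b δ - max b' δ| ≤ dist (a, b, c) (a', b', c') :=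
    (abs_max_sub_max_le_abs _ _ _).trans (by
      rw [Prod.dist_eq, Prod.dist_eq]; exact (le_max_left _ _).trans (le_max_right _ _))
  have d3 : |c - c'| ≤ dist (a, b, c) (a', b', c') := by
      rw [Prod.dist_eq, Prod.dist_eq]; exact (le_max_right _ _).trans (le_max_right _ _)
  have f1 := mul_le_mul_of_nonneg_left d1 hK1
  have f2 := mul_le_mul_of_nonneg_left d2 hK2
  have f3 := mul_le_mul_of_nonneg_left d3 hC
  rw [abs_le] at *
  constructor <;> linarith [e1.1, e1.2, e2.1, e2.2, e3.1, e3.2]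

lemma Wt_x {δ : ℝ} {p : ℝ × ℝ × ℝ} (hp1 : δ < p.1) (hp2 : δ < p.2.1) {a : ℝ}
    (ha : HasDerivAt (fun x => lax1 H₁ H₂ u₀ p.1 p.2.1 x) a p.2.2) :
    lineDeriv ℝ (Wt H₁ H₂ u₀ δ) p (0, 0, 1) = a := by
  unfold lineDeriv
  have : (fun t : ℝ => Wt H₁ H₂ u₀ δ (p + t • ((0, 0, 1) : ℝ × ℝ × ℝ)))
      = fun t => lax1 H₁ H₂ u₀ p.1 p.2.1 (p.2.2 + t) := by
    funext t
    simp [Wt, max_eq_left hp1.le, max_eq_left hp2.le]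
  rw [this]
  apply HasDerivAt.deriv
  apply HasDerivAt.comp_const_add
  simpa using ha

lemma Wt_t1 (h1 : Nice H₁) (h2 : Nice H₂) (hg : Lip C (fun y => ∫ s in (0:ℝ)..y, u₀ s))
    {δ : ℝ} (hδ : 0 < δ) {p : ℝ × ℝ × ℝ} (hp1 : δ < p.1) (hp2 : δ < p.2.1) {a : ℝ}
    (ha : HasDerivAt (fun x => lax1 H₁ H₂ u₀ p.1 p.2.1 x) a p.2.2)
    (hd : LineDifferentiableAt ℝ (Wt H₁ H₂ u₀ δ) p (1, 0, 0)) :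
    lineDeriv ℝ (Wt H₁ H₂ u₀ δ) p (1, 0, 0) = - H₁ a := by
  have l1 := hd.hasLineDerivAt.tendsto_slope_zero_right
  have l2 := qop_hj h1 (lax_lip h1 h2 hg (hδ.trans hp1) (hδ.trans hp2)) ha
  refine tendsto_nhds_unique (l1.congr' ?_) l2
  filter_upwards [self_mem_nhdsWithin] with h hh
  have hh : 0 < h := hh
  rw [← lax_step1 h1 h2 hg (hδ.trans hp1) (hδ.trans hp2) hh]
  simp [Wt, max_eq_left hp1.le, max_eq_left hp2.le, max_eq_left (hp1.le.trans (by linarith : p.1 ≤ p.1 + h))]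

lemma Wt_t2 (h1 : Nice H₁) (h2 : Nice H₂) (hg : Lip C (fun y => ∫ s in (0:ℝ)..y, u₀ s))
    {δ : ℝ} (hδ : 0 < δ) {p : ℝ × ℝ × ℝ} (hp1 : δ < p.1) (hp2 : δ < p.2.1) {a : ℝ}
    (ha : HasDerivAt (fun x => lax1 H₁ H₂ u₀ p.1 p.2.1 x) a p.2.2)
    (hd : LineDifferentiableAt ℝ (Wt H₁ H₂ u₀ δ) p (0, 1, 0)) :
    lineDeriv ℝ (Wt H₁ H₂ u₀ δ) p (0, 1, 0) = - H₂ a := by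
  have l1 := hd.hasLineDerivAt.tendsto_slope_zero_right
  have l2 := qop_hj h2 (lax_lip h1 h2 hg (hδ.trans hp1) (hδ.trans hp2)) ha
  refine tendsto_nhds_unique (l1.congr' ?_) l2
  filter_upwards [self_mem_nhdsWithin] with h hh
  have hh : 0 < h := hh
  rw [← lax_step2 h1 h2 hg (hδ.trans hp1) (hδ.trans hp2) hh]
  simp [Wt, max_eq_left hp1.le, max_eq_left hp2.le, max_eq_left (hp2.le.trans (by linarith : p.2.1 ≤ p.2.1 + h))]

end laxfacts

section ibp

instance haar3 : (volume : Measure (ℝ × ℝ × ℝ)).IsAddHaarMeasure := by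
  have : (volume : Measure (ℝ × ℝ)).IsAddHaarMeasure :=
    Measure.prod.instIsAddHaarMeasure (volume : Measure ℝ) (volume : Measure ℝ)
  exact Measure.prod.instIsAddHaarMeasure (volume : Measure ℝ) (volume : Measure (ℝ × ℝ))

variable {φ : ℝ × ℝ × ℝ → ℝ}

lemma fderiv_cs (hc : HasCompactSupport φ) (v : ℝ × ℝ × ℝ) :
    HasCompactSupport (fun p => fderiv ℝ φ p v) :=
  (hc.fderiv (𝕜 := ℝ)).comp_left (g := fun L : (ℝ × ℝ × ℝ) →L[ℝ] ℝ => L v) (by simp)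

lemma fderiv_smooth (hs : ContDiff ℝ (⊤ : ℕ∞) φ) (v : ℝ × ℝ × ℝ) :
    ContDiff ℝ 1 (fun p => fderiv ℝ φ p v) := by
  have : ContDiff ℝ 1 (fderiv ℝ φ) := hs.fderiv_right (by norm_cast)
  exact this.clm_apply contDiff_const

lemma ibp {W : ℝ × ℝ × ℝ → ℝ} {K : NNReal} (hW : LipschitzWith K W)
    (hs : ContDiff ℝ (⊤ : ℕ∞) φ) (hc : HasCompactSupport φ) (v e : ℝ × ℝ × ℝ) :
    ∫ p, (lineDeriv ℝ W p e * fderiv ℝ φ p v - lineDeriv ℝ W p v * fderiv ℝ φ p e) = 0 := by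
  have hint : ∀ a b : ℝ × ℝ × ℝ, Integrable (fun p => lineDeriv ℝ W p a * fderiv ℝ φ p b) := by
    intro a b
    have := (hW.locallyIntegrable_lineDeriv (μ := volume) a).integrable_smul_right_of_hasCompactSupport
      (fderiv_smooth hs b).continuous (fderiv_cs hc b)
    simpa using this
  have hI : ∀ a b : ℝ × ℝ × ℝ, ∫ p, lineDeriv ℝ W p a * fderiv ℝ φ p b
      = ∫ p, - (fderiv ℝ (fderiv ℝ φ) p a b) * W p := by
    intro a b
    obtain ⟨D, hD⟩ := ContDiff.lipschitzWith_of_hasCompactSupport (fderiv_cs hc b)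
      (fderiv_smooth hs b) (by simp)
    rw [hW.integral_lineDeriv_mul_eq hD (fderiv_cs hc b)]
    congr 1
    funext p
    congr 1
    rw [((fderiv_smooth hs b).differentiable (by simp) p).lineDeriv_eq_fderiv]
    have hd : DifferentiableAt ℝ (fderiv ℝ φ) p :=
      (hs.fderiv_right (m := 1) (by norm_cast)).differentiable (by simp) p
    rw [fderiv_clm_apply hd (by fun_prop)]
    simp
  rw [integral_sub (hint _ _) (hint _ _), hI, hI, sub_eq_zero]
  congr 1
  funext p
  have := (hs.contDiffAt (x := p)).isSymmSndFDerivAt (by simp; norm_cast)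
  rw [this e v]

lemma weak_abs {W : ℝ × ℝ × ℝ → ℝ} {K : NNReal} (hW : LipschitzWith K W)
    (hs : ContDiff ℝ (⊤ : ℕ∞) φ) (hc : HasCompactSupport φ) (v e : ℝ × ℝ × ℝ)
    (u : ℝ × ℝ × ℝ → ℝ) (H : ℝ → ℝ)
    (hae : ∀ᵐ p : ℝ × ℝ × ℝ, p ∈ tsupport φ →
      lineDeriv ℝ W p e = u p ∧ lineDeriv ℝ W p v = - H (u p)) :
    ∫ p, (u p * fderiv ℝ φ p v + H (u p) * fderiv ℝ φ p e) = 0 := by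
  rw [← ibp hW hs hc v e]
  apply MeasureTheory.integral_congr_ae
  filter_upwards [hae] with p hp
  by_cases h : p ∈ tsupport φ
  · rw [(hp h).1, (hp h).2]; ring
  · rw [show fderiv ℝ φ p = 0 from image_eq_zero_of_notMem_tsupport
      (fun h' => h (tsupport_fderiv_subset ℝ h'))]
    simp
end ibp

lemma ibp1 {F d ψ : ℝ → ℝ} {K : NNReal} (hF : LipschitzWith K F) {B : ℝ} (hB : ∀ x, |F x| ≤ B)
    (hd : ∀ᵐ x, HasDerivAt F (d x) x) (hψ : ContDiff ℝ 1 ψ) (hc : HasCompactSupport ψ) :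
    |∫ x, d x * ψ x| ≤ B * ∫ x, |lineDeriv ℝ ψ x (-1)| := by
  obtain ⟨D, hD⟩ := ContDiff.lipschitzWith_of_hasCompactSupport hc hψ (by simp)
  have h1 : ∫ x, d x * ψ x = ∫ x, lineDeriv ℝ F x 1 * ψ x := by
    apply MeasureTheory.integral_congr_ae
    filter_upwards [hd] with x hx
    rw [hx.differentiableAt.lineDeriv_eq_fderiv]
    simp [hx.deriv]
  have hi : Integrable (fun x => lineDeriv ℝ ψ x (-1)) := by
    have : (fun x => lineDeriv ℝ ψ x (-1)) = fun x => - deriv ψ x := by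
      funext x
      rw [(hψ.differentiable (by simp) x).lineDeriv_eq_fderiv]
      simp
    rw [this]
    exact ((hψ.continuous_deriv le_rfl).integrable_of_hasCompactSupport hc.deriv).neg
  rw [h1, hF.integral_lineDeriv_mul_eq hD hc, ← Real.norm_eq_abs, ← MeasureTheory.integral_const_mul]
  apply MeasureTheory.norm_integral_le_of_norm_le (hi.abs.const_mul B)
  refine .of_forall fun x => ?_
  rw [Real.norm_eq_abs, abs_mul, mul_comm]
  exact mul_le_mul_of_nonneg_right (hB x) (abs_nonneg _)

/-- Let `H₁, H₂` be smooth and uniformly convex with `H₁(0) = H₂(0) = 0`, `u₀ ∈ L^∞(ℝ)`,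
and let `w` be the multi-time Lax formula with initial datum `g(x) = ∫₀ˣ u₀`. Then the
bounded measurable function `u` given (a.e.) by `u = ∂ₓ w` is a weak integral solution of
the multi-time system of conservation laws `u_{t₁} + ∂ₓ H₁(u) = 0`,
`u_{t₂} + ∂ₓ H₂(u) = 0`, `u(0,0,·) = u₀`: the two weak formulations hold for every test
function `φ ∈ C_c^∞((0,∞)² × ℝ)`, and for every `γ ∈ L¹(ℝ)` the essential limit as
`(t₁,t₂) → (0,0)⁺` of `∫ (u(t₁,t₂,x) - u₀ x) γ x dx` is `0`. -/
theorem lax_oleinik_is_weak_integral_solution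
    (H₁ H₂ : ℝ → ℝ)
    (hH₁s : ContDiff ℝ (⊤ : ℕ∞) H₁) (hH₂s : ContDiff ℝ (⊤ : ℕ∞) H₂)
    (c₁ : ℝ) (hc₁ : 0 < c₁) (hH₁u : ∀ x : ℝ, c₁ ≤ iteratedDeriv 2 H₁ x)
    (c₂ : ℝ) (hc₂ : 0 < c₂) (hH₂u : ∀ x : ℝ, c₂ ≤ iteratedDeriv 2 H₂ x)
    (hH₁0 : H₁ 0 = 0) (hH₂0 : H₂ 0 = 0)
    (u₀ : ℝ → ℝ) (hu₀m : Measurable u₀) (C₀ : ℝ) (hu₀b : ∀ x, |u₀ x| ≤ C₀)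
    (u : ℝ × ℝ × ℝ → ℝ) (hum : Measurable u) (Cu : ℝ) (hub : ∀ p, |u p| ≤ Cu)
    (hu : ∀ᵐ p : ℝ × ℝ × ℝ ∂volume, 0 < p.1 → 0 < p.2.1 →
      HasDerivAt (fun x => lax1 H₁ H₂ u₀ p.1 p.2.1 x) (u p) p.2.2) :
    (∀ φ : ℝ × ℝ × ℝ → ℝ, ContDiff ℝ (⊤ : ℕ∞) φ → HasCompactSupport φ →
      tsupport φ ⊆ {p : ℝ × ℝ × ℝ | 0 < p.1 ∧ 0 < p.2.1} →
      (∫ p : ℝ × ℝ × ℝ,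
          (u p * deriv (fun s => φ (s, p.2)) p.1
            + H₁ (u p) * deriv (fun x => φ (p.1, p.2.1, x)) p.2.2)) = 0 ∧
      (∫ p : ℝ × ℝ × ℝ,
          (u p * deriv (fun s => φ (p.1, s, p.2.2)) p.2.1
            + H₂ (u p) * deriv (fun x => φ (p.1, p.2.1, x)) p.2.2)) = 0) ∧
    (∀ γ : ℝ → ℝ, Integrable γ →
      Tendsto (fun t : ℝ × ℝ => ∫ x : ℝ, (u (t.1, t.2, x) - u₀ x) * γ x)
        ((𝓝[Set.Ioi (0:ℝ) ×ˢ Set.Ioi (0:ℝ)] (0, 0)) ⊓ ae (volume : Measure (ℝ × ℝ)))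
        (𝓝 0)) := by
  have hn1 := nice_of hH₁s hc₁ hH₁u
  have hn2 := nice_of hH₂s hc₂ hH₂u
  have hC : 0 ≤ C₀ := (abs_nonneg _).trans (hu₀b 0)
  have hg := g_lip hu₀m hu₀b
  constructor
  · intro φ hs hc hsub
    obtain ⟨δ, hδ, hδ'⟩ : ∃ δ > 0, ∀ p ∈ tsupport φ, δ < p.1 ∧ δ < p.2.1 := by
      obtain ⟨a, ha, ha'⟩ := hc.isCompact.exists_forall_le' (f := fun p : ℝ × ℝ × ℝ => min p.1 p.2.1)
        (by fun_prop) (a := 0) (fun p hp => lt_min (hsub hp).1 (hsub hp).2)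
      refine ⟨a / 2, by positivity, fun p hp => ?_⟩
      have := ha' p hp
      have h1 := this.trans (min_le_left _ _)
      have h2 := this.trans (min_le_right _ _)
      constructor <;> linarith
    have hW := Wt_lip hn1 hn2 hC hg hδ
    have hdφ : ∀ p, DifferentiableAt ℝ φ p := hs.differentiable (by simp)
    have e1 : ∀ p : ℝ × ℝ × ℝ, deriv (fun s => φ (s, p.2)) p.1 = fderiv ℝ φ p (1, 0, 0) := by
      intro p
      have hl : HasDerivAt (fun s : ℝ => (s, p.2)) ((1, 0, 0) : ℝ × ℝ × ℝ) p.1 :=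
        (hasDerivAt_id p.1).prodMk (hasDerivAt_const p.1 p.2)
      exact ((hdφ p).hasFDerivAt.comp_hasDerivAt p.1 hl).deriv
    have e2 : ∀ p : ℝ × ℝ × ℝ, deriv (fun s => φ (p.1, s, p.2.2)) p.2.1
        = fderiv ℝ φ p (0, 1, 0) := by
      intro p
      have hl : HasDerivAt (fun s : ℝ => (p.1, s, p.2.2)) ((0, 1, 0) : ℝ × ℝ × ℝ) p.2.1 :=
        (hasDerivAt_const p.2.1 p.1).prodMk
          ((hasDerivAt_id p.2.1).prodMk (hasDerivAt_const p.2.1 p.2.2))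
      exact ((hdφ p).hasFDerivAt.comp_hasDerivAt p.2.1 hl).deriv
    have e3 : ∀ p : ℝ × ℝ × ℝ, deriv (fun s => φ (p.1, p.2.1, s)) p.2.2
        = fderiv ℝ φ p (0, 0, 1) := by
      intro p
      have hl : HasDerivAt (fun s : ℝ => (p.1, p.2.1, s)) ((0, 0, 1) : ℝ × ℝ × ℝ) p.2.2 :=
        (hasDerivAt_const p.2.2 p.1).prodMk
          ((hasDerivAt_const p.2.2 p.2.1).prodMk (hasDerivAt_id p.2.2))
      exact ((hdφ p).hasFDerivAt.comp_hasDerivAt p.2.2 hl).deriv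
    simp only [e1, e2, e3]
    constructor
    · apply weak_abs hW hs hc
      filter_upwards [hu, hW.ae_lineDifferentiableAt (μ := volume) (1, 0, 0)] with p hp hd hm
      obtain ⟨hp1, hp2⟩ := hδ' p hm
      have ha := hp (hδ.trans hp1) (hδ.trans hp2)
      exact ⟨Wt_x hp1 hp2 ha, Wt_t1 hn1 hn2 hg hδ hp1 hp2 ha hd⟩
    · apply weak_abs hW hs hc
      filter_upwards [hu, hW.ae_lineDifferentiableAt (μ := volume) (0, 1, 0)] with p hp hd hm
      obtain ⟨hp1, hp2⟩ := hδ' p hm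
      have ha := hp (hδ.trans hp1) (hδ.trans hp2)
      exact ⟨Wt_x hp1 hp2 ha, Wt_t2 hn1 hn2 hg hδ hp1 hp2 ha hd⟩
  · intro γ hγ
    have hae : ∀ᵐ t : ℝ × ℝ, ∀ᵐ x : ℝ, 0 < t.1 → 0 < t.2 →
        HasDerivAt (fun x => lax1 H₁ H₂ u₀ t.1 t.2 x) (u (t.1, t.2, x)) x := by
      have := (MeasureTheory.measurePreserving_prodAssoc (volume : Measure ℝ) (volume : Measure ℝ)
        (volume : Measure ℝ)).quasiMeasurePreserving.ae hu
      exact Measure.ae_ae_of_ae_prod this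
    have hg' : ∀ᵐ x : ℝ, HasDerivAt (fun x => ∫ s in (0:ℝ)..x, u₀ s) (u₀ x) x := by
      filter_upwards [LocallyIntegrable.ae_hasDerivAt_integral (bdd_locInt hu₀m hu₀b)] with x hx
      exact hx 0
    have hCu : 0 ≤ Cu := (abs_nonneg _).trans (hub 0)
    set M := Cu + C₀ + 1 with hM
    have hM0 : 0 < M := by positivity
    rw [Metric.tendsto_nhds]
    intro ε hε
    obtain ⟨ψ, hψc, hψs, hψ⟩ := (memLp_one_iff_integrable.2 hγ).exist_eLpNorm_sub_le
      ENNReal.one_ne_top le_rfl (show 0 < ε / (2 * M) by positivity)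
    have hψi : Integrable ψ := hψs.continuous.integrable_of_hasCompactSupport hψc
    have hψ' : ∫ x, |γ x - ψ x| ≤ ε / (2 * M) := by
      have h1 : ∫ x, ‖(γ - ψ) x‖ = (∫⁻ x, ‖(γ - ψ) x‖ₑ).toReal :=
        integral_norm_eq_lintegral_enorm (hγ.sub hψi).aestronglyMeasurable
      rw [← eLpNorm_one_eq_lintegral_enorm] at h1
      have h2 : (eLpNorm (γ - ψ) 1 volume).toReal ≤ ε / (2 * M) :=
        ENNReal.toReal_le_of_le_ofReal (by positivity) hψ
      rw [← h1] at h2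
      exact h2
    set I := ∫ x, |lineDeriv ℝ ψ x (-1)| with hI
    have hlim : Tendsto (fun t : ℝ × ℝ => (Kc H₁ C₀ * t.1 + Kc H₂ C₀ * t.2) * I)
        (𝓝 (0, 0)) (𝓝 0) := by
      have : Continuous (fun t : ℝ × ℝ => (Kc H₁ C₀ * t.1 + Kc H₂ C₀ * t.2) * I) := by fun_prop
      simpa using this.tendsto (0, 0)
    have ev1 : ∀ᶠ t in (𝓝[Set.Ioi (0:ℝ) ×ˢ Set.Ioi (0:ℝ)] ((0:ℝ), (0:ℝ))) ⊓
        ae (volume : Measure (ℝ × ℝ)), (Kc H₁ C₀ * t.1 + Kc H₂ C₀ * t.2) * I < ε / 2 :=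
      ((hlim.mono_left nhdsWithin_le_nhds).mono_left inf_le_left).eventually
        (gt_mem_nhds (half_pos hε))
    have ev2 : ∀ᶠ t in (𝓝[Set.Ioi (0:ℝ) ×ˢ Set.Ioi (0:ℝ)] ((0:ℝ), (0:ℝ))) ⊓
        ae (volume : Measure (ℝ × ℝ)), t ∈ Set.Ioi (0:ℝ) ×ˢ Set.Ioi (0:ℝ) :=
      Filter.Eventually.filter_mono inf_le_left self_mem_nhdsWithin
    filter_upwards [ev1, ev2, Filter.Eventually.filter_mono inf_le_right hae] with t ht1 ht2 ht3
    obtain ⟨hp1, hp2⟩ : 0 < t.1 ∧ 0 < t.2 := ht2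
    have hmeas : AEStronglyMeasurable (fun x => u (t.1, t.2, x) - u₀ x) volume := by
      have : Measurable (fun x => u (t.1, t.2, x) - u₀ x) := by fun_prop
      exact this.aestronglyMeasurable
    have hbd : ∀ x, |u (t.1, t.2, x) - u₀ x| ≤ M := by
      intro x
      have := abs_le.1 (hub (t.1, t.2, x))
      have := abs_le.1 (hu₀b x)
      rw [abs_le]; constructor <;> linarith
    have hi1 : Integrable (fun x => (u (t.1, t.2, x) - u₀ x) * ψ x) :=
      hψi.bdd_mul hmeas (.of_forall hbd)
    have hi2 : Integrable (fun x => (u (t.1, t.2, x) - u₀ x) * (γ x - ψ x)) :=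
      (hγ.sub hψi).bdd_mul hmeas (.of_forall hbd)
    have hsplit : ∫ x, (u (t.1, t.2, x) - u₀ x) * γ x
        = (∫ x, (u (t.1, t.2, x) - u₀ x) * ψ x)
          + ∫ x, (u (t.1, t.2, x) - u₀ x) * (γ x - ψ x) := by
      rw [← MeasureTheory.integral_add hi1 hi2]
      congr 1; funext x; ring
    have b1 : |∫ x, (u (t.1, t.2, x) - u₀ x) * ψ x|
        ≤ (Kc H₁ C₀ * t.1 + Kc H₂ C₀ * t.2) * I := by
      apply ibp1 (F := fun x => lax1 H₁ H₂ u₀ t.1 t.2 x - ∫ s in (0:ℝ)..x, u₀ s)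
        (K := (2 * C₀).toNNReal) _ (lax_init hn1 hn2 hg hp1 hp2) _ (hψs.of_le (by norm_cast)) hψc
      · apply LipschitzWith.of_dist_le_mul
        intro x y
        rw [Real.coe_toNNReal _ (by positivity), Real.dist_eq, Real.dist_eq]
        have a1 := abs_le.1 (lax_lip hn1 hn2 hg hp1 hp2 x y)
        have a2 := abs_le.1 (hg x y)
        rw [abs_le]
        constructor <;> linarith [a1.1, a1.2, a2.1, a2.2]
      · filter_upwards [ht3, hg'] with x hx hx'
        exact (hx hp1 hp2).sub hx'
    have b2 : |∫ x, (u (t.1, t.2, x) - u₀ x) * (γ x - ψ x)| ≤ ε / 2 := by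
      calc |∫ x, (u (t.1, t.2, x) - u₀ x) * (γ x - ψ x)|
          ≤ ∫ x, M * |γ x - ψ x| := by
            rw [← Real.norm_eq_abs]
            apply MeasureTheory.norm_integral_le_of_norm_le ((hγ.sub hψi).abs.const_mul M)
            refine .of_forall fun x => ?_
            rw [Real.norm_eq_abs, abs_mul]
            exact mul_le_mul_of_nonneg_right (hbd x) (abs_nonneg _)
        _ = M * ∫ x, |γ x - ψ x| := MeasureTheory.integral_const_mul _ _
        _ ≤ M * (ε / (2 * M)) := by gcongr
        _ = ε / 2 := by field_simp
    rw [Real.dist_eq, sub_zero, hsplit]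
    refine (abs_add_le _ _).trans_lt ?_
    linarith
end
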